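/- Let A_S be an Artin-Tits group of large type. For S₀ ⊆ S, let T(S₀) denote the set of elements of A_S that are of minimal length in their left A_{S₀}-coset. Then the family (T(S₀))_{S₀ ⊆ S} is an S-sequence of transversals: each T(S₀) contains 1 and contains exactly one element of each left A_{S₀}-coset. -/

import Mathlib

namespace ArtinTits

open Classical List

variable {S : Type*}

/-- A word over `S ∪ S⁻¹`: a list of letters, each a generator together with a sign
(`true` = the generator itself, `false` = its formal inverse). -/
abbrev Word (S : Type*) := List (S × Bool)

/-- The formal inverse of a word. -/
def wordInv (w : Word S) : Word S := w.reverse.map fun l => (l.1, !l.2)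

/-- `[x,y,j⟩`: the alternating positive word `xyxy⋯` with `j` letters, beginning with `x`. -/
def altWord (x y : S) : ℕ → Word S
  | 0 => []
  | j + 1 => (x, true) :: altWord y x j

/-- `⟨x,y,j]`: the alternating positive word `⋯xy` with `j` letters, ending with `y`. -/
def altWordR (x y : S) (j : ℕ) : Word S := (altWord y x j).reverse

/-- The data of a labelled finite complete simplicial graph `Γ₀`: a symmetric label map
with values in `{2,3,…} ∪ {∞}` on pairs of distinct vertices. -/
structure ArtinData (S : Type*) where
  m : S → S → ℕ∞
  symm : ∀ s t, m s t = m t s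
  two_le : ∀ s t : S, s ≠ t → 2 ≤ m s t

/-- `u = v` is a defining (braid) relation of the Artin–Tits presentation. -/
def IsRel (A : ArtinData S) (u v : Word S) : Prop :=
  ∃ (s t : S) (k : ℕ), s ≠ t ∧ A.m s t = (k : ℕ∞) ∧
    u = altWord s t k ∧ v = altWord t s k

/-- The relator set of the Artin–Tits presentation, inside the free group. -/
def rels (A : ArtinData S) : Set (FreeGroup S) :=
  {x | ∃ u v : Word S, IsRel A u v ∧ x = FreeGroup.mk u * (FreeGroup.mk v)⁻¹}

/-- The Artin–Tits group `A(Γ₀)` of the presentation. -/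
abbrev ArtinGroup (A : ArtinData S) := PresentedGroup (rels A)

/-- `w̄`: the element of the Artin–Tits group represented by the word `w`. -/
def wbar (A : ArtinData S) (w : Word S) : ArtinGroup A :=
  PresentedGroup.mk (rels A) (FreeGroup.mk w)

/-! ### Special transformations -/

/-- Type 0: delete a factor `s s⁻¹` or `s⁻¹ s`. -/
def Step0 (w w' : Word S) : Prop :=
  ∃ (w₁ w₂ : Word S) (s : S) (b : Bool),
    w = w₁ ++ [(s, b), (s, !b)] ++ w₂ ∧ w' = w₁ ++ w₂

/-- Type ∞: insert a factor `s s⁻¹` or `s⁻¹ s` (the inverse of type 0). -/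
def StepInfty (w w' : Word S) : Prop := Step0 w' w

/-- Type 1: replace a factor `v` by `u`, or `v⁻¹` by `u⁻¹`, where `u = v` is a defining
relation. -/
def Step1 (A : ArtinData S) (w w' : Word S) : Prop :=
  ∃ (w₁ w₂ u v : Word S), IsRel A u v ∧
    ((w = w₁ ++ v ++ w₂ ∧ w' = w₁ ++ u ++ w₂) ∨
     (w = w₁ ++ wordInv v ++ w₂ ∧ w' = w₁ ++ wordInv u ++ w₂))

/-- Type 2r: for a defining relation `u₁u₂ = v₁v₂` with `u₁, v₁` non-empty, replace a factor
`v₁⁻¹ u₁` by `v₂ u₂⁻¹`. -/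
def Step2r (A : ArtinData S) (w w' : Word S) : Prop :=
  ∃ (w₁ w₂ u₁ u₂ v₁ v₂ : Word S), IsRel A (u₁ ++ u₂) (v₁ ++ v₂) ∧
    u₁ ≠ [] ∧ v₁ ≠ [] ∧
    w = w₁ ++ wordInv v₁ ++ u₁ ++ w₂ ∧ w' = w₁ ++ v₂ ++ wordInv u₂ ++ w₂

/-- Type 2l: for a defining relation `u₁u₂ = v₁v₂` with `u₂, v₂` non-empty, replace a factor
`v₂ u₂⁻¹` by `v₁⁻¹ u₁`. -/
def Step2l (A : ArtinData S) (w w' : Word S) : Prop :=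
  ∃ (w₁ w₂ u₁ u₂ v₁ v₂ : Word S), IsRel A (u₁ ++ u₂) (v₁ ++ v₂) ∧
    u₂ ≠ [] ∧ v₂ ≠ [] ∧
    w = w₁ ++ v₂ ++ wordInv u₂ ++ w₂ ∧ w' = w₁ ++ wordInv v₁ ++ u₁ ++ w₂

/-- Type 2: a type 2r or type 2l transformation. -/
def Step2 (A : ArtinData S) (w w' : Word S) : Prop := Step2r A w w' ∨ Step2l A w w'

/-- `p` is the greatest (longest) common left factor of `x` and `y`. -/
def IsLCPrefix (p x y : Word S) : Prop :=
  p <+: x ∧ p <+: y ∧ ∀ q : Word S, q <+: x → q <+: y → q.length ≤ p.length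

/-- `p` is the greatest (longest) common right factor of `x` and `y`. -/
def IsLCSuffix (p x y : Word S) : Prop :=
  p <:+ x ∧ p <:+ y ∧ ∀ q : Word S, q <:+ x → q <:+ y → q.length ≤ p.length

/-- Type 2r⋆ : a type 2r transformation `w₁ v⁻¹ v' w₂ → w₁ u (u')⁻¹ w₂` (with `vu = v'u'` a
defining relation) such that `v` is the greatest common left factor of `vu` and `v w₁⁻¹`, and
`v'` is the greatest common left factor of `v'u'` and `v' w₂`. -/
def Step2rStar (A : ArtinData S) (w w' : Word S) : Prop :=
  ∃ (w₁ w₂ v u v' u' : Word S), IsRel A (v ++ u) (v' ++ u') ∧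
    v ≠ [] ∧ v' ≠ [] ∧
    w = w₁ ++ wordInv v ++ v' ++ w₂ ∧
    w' = w₁ ++ u ++ wordInv u' ++ w₂ ∧
    IsLCPrefix v (v ++ u) (v ++ wordInv w₁) ∧
    IsLCPrefix v' (v' ++ u') (v' ++ w₂)

/-- Type 2l⋆ : a type 2l transformation `w₁ v (v')⁻¹ w₂ → w₁ u⁻¹ u' w₂` (with `uv = u'v'` a
defining relation) such that `v` is the greatest common right factor of `uv` and `w₁ v`, and
`v'` is the greatest common right factor of `u'v'` and `w₂⁻¹ v'`. -/
def Step2lStar (A : ArtinData S) (w w' : Word S) : Prop :=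
  ∃ (w₁ w₂ v u v' u' : Word S), IsRel A (u ++ v) (u' ++ v') ∧
    v ≠ [] ∧ v' ≠ [] ∧
    w = w₁ ++ v ++ wordInv v' ++ w₂ ∧
    w' = w₁ ++ wordInv u ++ u' ++ w₂ ∧
    IsLCSuffix v (u ++ v) (w₁ ++ v) ∧
    IsLCSuffix v' (u' ++ v') (wordInv w₂ ++ v')

/-- Type 2⋆ : a type 2r⋆ or type 2l⋆ transformation. -/
def Step2Star (A : ArtinData S) (w w' : Word S) : Prop :=
  Step2rStar A w w' ∨ Step2lStar A w w'

/-- `w →_{0,1,2} w'`. -/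
def Steps012 (A : ArtinData S) : Word S → Word S → Prop :=
  Relation.ReflTransGen fun x y => Step0 x y ∨ Step1 A x y ∨ Step2 A x y

/-- `w →_{0,1,2⋆} w'`. -/
def Steps012Star (A : ArtinData S) : Word S → Word S → Prop :=
  Relation.ReflTransGen fun x y => Step0 x y ∨ Step1 A x y ∨ Step2Star A x y

/-- `w →_{2⋆} w'`. -/
def Steps2Star (A : ArtinData S) : Word S → Word S → Prop :=
  Relation.ReflTransGen (Step2Star A)

/-- `w →_{1,2⋆} w'`. -/
def Steps12Star (A : ArtinData S) : Word S → Word S → Prop :=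
  Relation.ReflTransGen fun x y => Step1 A x y ∨ Step2Star A x y

/-- `w →_{1,2} w'`. -/
def Steps12 (A : ArtinData S) : Word S → Word S → Prop :=
  Relation.ReflTransGen fun x y => Step1 A x y ∨ Step2 A x y

/-! ### Classes of words -/

/-- A positive word: written over `S`. -/
def Positive (w : Word S) : Prop := ∀ l ∈ w, l.2 = true

/-- A negative word: written over `S⁻¹`. -/
def Negative (w : Word S) : Prop := ∀ l ∈ w, l.2 = false

/-- A signed word: positive or negative. -/
def Signed (w : Word S) : Prop := Positive w ∨ Negative w

/-- An unsigned word: neither positive nor negative. -/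
def Unsigned (w : Word S) : Prop := ¬ Positive w ∧ ¬ Negative w

/-- A freely reduced word: no factor `s s⁻¹` or `s⁻¹ s`. -/
def FreelyReduced (w : Word S) : Prop :=
  ∀ (w₁ w₂ : Word S) (s : S) (b : Bool), w ≠ w₁ ++ [(s, b), (s, !b)] ++ w₂

/-- A square-free word: no factor `aa`. -/
def SquareFree (w : Word S) : Prop := ∀ a : S × Bool, ¬ [a, a] <:+: w

/-- `p̃(w)`: the length of the longest square-free positive factor of `w`. -/
noncomputable def ptilde (w : Word S) : ℕ :=
  sSup {n | ∃ v : Word S, v <:+: w ∧ Positive v ∧ SquareFree v ∧ v.length = n}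

/-- `ñ(w)`: the length of the longest negative factor of `w` whose formal inverse is
square-free. -/
noncomputable def ntilde (w : Word S) : ℕ :=
  sSup {n | ∃ v : Word S, v <:+: w ∧ Negative v ∧ SquareFree (wordInv v) ∧ v.length = n}

/-- `p(w) = min(p̃(w), m)`. -/
noncomputable def pfun (M : ℕ) (w : Word S) : ℕ := min (ptilde w) M

/-- `n(w) = min(ñ(w), m)`. -/
noncomputable def nfun (M : ℕ) (w : Word S) : ℕ := min (ntilde w) M

/-- `Ω(Γ₀)` (for a dihedral presentation with label `M`): the freely reduced words with
`max(p(w), n(w)) < M`. -/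
def Omega (M : ℕ) (w : Word S) : Prop :=
  FreelyReduced w ∧ max (pfun M w) (nfun M w) < M

/-- A signed square-free word (square-free positive, or negative with square-free inverse). -/
def SignedSF (w : Word S) : Prop :=
  (Positive w ∧ SquareFree w) ∨ (Negative w ∧ SquareFree (wordInv w))

/-- `v` is the maximal square-free signed left factor of `w`. -/
def MaxSignedSFPrefix (v w : Word S) : Prop :=
  v <+: w ∧ SignedSF v ∧ ∀ v' : Word S, v' <+: w → SignedSF v' → v'.length ≤ v.length

/-- `(v₁, …, v_k)` is the `⋆`-decomposition of `w`: the `v_i` are non-empty, `w = v₁⋯v_k`,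
and each `v_i` is the maximal square-free signed left factor of `v_i⋯v_k`. -/
def StarDecomp (w : Word S) (L : List (Word S)) : Prop :=
  w = L.flatten ∧ (∀ v ∈ L, v ≠ ([] : Word S)) ∧
    ∀ i (h : i < L.length), MaxSignedSFPrefix (L.get ⟨i, h⟩) ((L.drop i).flatten)

/-! ### Groups, parabolic subgroups, geodesics -/

/-- A word written over `T ∪ T⁻¹` for a subset `T` of the generators. -/
def WordOver (T : Set S) (w : Word S) : Prop := ∀ l ∈ w, l.1 ∈ T

/-- The standard parabolic subgroup `A_T` generated by the image of `T ⊆ S`. -/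
def parab (A : ArtinData S) (T : Set S) : Subgroup (ArtinGroup A) :=
  Subgroup.closure {x | ∃ s ∈ T, x = wbar A [(s, true)]}

/-- A geodesic word: of minimal length among all words representing the same element. -/
def Geodesic (A : ArtinData S) (w : Word S) : Prop :=
  ∀ w' : Word S, wbar A w' = wbar A w → w.length ≤ w'.length

/-- A word over `T ∪ T⁻¹` that is geodesic among the words over `T ∪ T⁻¹` representing the
same element. -/
def GeodesicOver (A : ArtinData S) (T : Set S) (w : Word S) : Prop :=
  WordOver T w ∧
    ∀ w' : Word S, WordOver T w' → wbar A w' = wbar A w → w.length ≤ w'.length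

/-- The length of a group element: the length of any geodesic representative word. -/
noncomputable def elLength (A : ArtinData S) (g : ArtinGroup A) : ℕ :=
  sInf {n | ∃ w : Word S, wbar A w = g ∧ w.length = n}

/-- A positive element: one represented by a positive word. -/
def IsPosElt (A : ArtinData S) (g : ArtinGroup A) : Prop :=
  ∃ w : Word S, Positive w ∧ wbar A w = g

/-- An `H`-transversal: a subset containing `1` and exactly one element of each left
`H`-coset. -/
def IsLeftTransversal {G : Type*} [Group G] (H : Subgroup G) (T : Set G) : Prop :=
  (1 : G) ∈ T ∧ ∀ g : G, ∃! x, x ∈ T ∧ g⁻¹ * x ∈ H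

/-! ### Properties H, H⁺, H# -/

/-- Property `H`: `w →_{0,1,2} ε ↔ w̄ = 1`. -/
def PropertyH (A : ArtinData S) : Prop :=
  ∀ w : Word S, Steps012 A w [] ↔ wbar A w = 1

/-- Property `H⁺`: every word representing an element of a standard parabolic subgroup
`A_{S₀}` can be transformed by `→_{0,1,2⋆}` into a word over `S₀ ∪ S₀⁻¹`. -/
def PropertyHPlus (A : ArtinData S) : Prop :=
  ∀ (S₀ : Set S) (w : Word S), wbar A w ∈ parab A S₀ →
    ∃ w₀ : Word S, WordOver S₀ w₀ ∧ Steps012Star A w w₀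

/-- Property `H#` with respect to an `S`-sequence of transversals `T`. -/
def PropertyHSharpWrt (A : ArtinData S) (T : Set S → Set (ArtinGroup A)) : Prop :=
  (∀ S₀ : Set S, IsLeftTransversal (parab A S₀) (T S₀)) ∧
    ∀ (S' S₀ : Set S) (w : Word S), wbar A w ∈ parab A S' →
      ∃ v u : Word S, WordOver S' v ∧ WordOver (S' ∩ S₀) u ∧
        Steps012 A w (v ++ u) ∧ wbar A v ∈ T S₀

/-- Property `H#`: property `H#` with respect to some `S`-sequence of transversals. -/
def PropertyHSharp (A : ArtinData S) : Prop :=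
  ∃ T : Set S → Set (ArtinGroup A), PropertyHSharpWrt A T

/-! ### Critical words and the involution τ (relative to a dihedral pair) -/

/-- The permutation `δ` induced by conjugation by `Δ`, extended letterwise to words:
the identity if `M` is even, and the swap of `s` and `t` if `M` is odd. -/
noncomputable def deltaMap (s t : S) (M : ℕ) (w : Word S) : Word S :=
  if Even M then w
  else w.map fun l => (if l.1 = s then t else if l.1 = t then s else l.1, l.2)

/-- `w` is an unsigned critical word (of the dihedral pair `{s,t}` with label `M`) and
`w' = τ(w)`. -/
def UCritTauPair (A : ArtinData S) (s t : S) (M : ℕ) (w w' : Word S) : Prop :=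
  WordOver {s, t} w ∧ FreelyReduced w ∧ Unsigned w ∧ GeodesicOver A {s, t} w ∧
  pfun M w + nfun M w = M ∧
  ∃ (x y z z' : S) (wm : Word S),
    ({x, y} : Set S) = {s, t} ∧ ({z, z'} : Set S) = {s, t} ∧
    ((w = altWord x y (pfun M w) ++ wm ++ wordInv (altWord z z' (nfun M w)) ∧
      w' = wordInv (altWordR x y (nfun M w)) ++ deltaMap s t M wm ++
        altWordR z z' (pfun M w)) ∨
     (w = wordInv (altWordR x y (nfun M w)) ++ wm ++ altWordR z z' (pfun M w) ∧
      w' = altWord x y (pfun M w) ++ deltaMap s t M wm ++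
        wordInv (altWord z z' (nfun M w))))

/-- `w` is a positive critical word (of the dihedral pair `{s,t}` with label `M`) and
`w' = τ(w)`. -/
def PosCritTauPair (A : ArtinData S) (s t : S) (M : ℕ) (w w' : Word S) : Prop :=
  WordOver {s, t} w ∧ Positive w ∧ pfun M w = M ∧
  ∃ (x y : S) (wm : Word S), ({x, y} : Set S) = {s, t} ∧ pfun M wm < M ∧
    ((w = altWord x y M ++ wm ∧
      (w' = deltaMap s t M wm ++ altWordR x y M ∨
       w' = deltaMap s t M wm ++ altWordR y x M) ∧
      w'.getLast? ≠ w.getLast?) ∨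
     (w = wm ++ altWordR x y M ∧
      (w' = altWord x y M ++ deltaMap s t M wm ∨
       w' = altWord y x M ++ deltaMap s t M wm) ∧
      w'.head? ≠ w.head?))

/-- `w` is a negative critical word and `w' = τ(w)` (defined via formal inverses). -/
def NegCritTauPair (A : ArtinData S) (s t : S) (M : ℕ) (w w' : Word S) : Prop :=
  PosCritTauPair A s t M (wordInv w) (wordInv w')

/-- `w` is a critical word (unsigned, positive or negative) and `w' = τ(w)`. -/
def CritTauPair (A : ArtinData S) (s t : S) (M : ℕ) (w w' : Word S) : Prop :=
  UCritTauPair A s t M w w' ∨ PosCritTauPair A s t M w w' ∨ NegCritTauPair A s t M w w'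

/-- A type β transformation relative to the dihedral pair `{s,t}` with label `M`:
replace a critical factor `v` by `τ(v)`. -/
def StepBetaPair (A : ArtinData S) (s t : S) (M : ℕ) (w w' : Word S) : Prop :=
  ∃ (w₁ w₂ v v' : Word S), w = w₁ ++ v ++ w₂ ∧ w' = w₁ ++ v' ++ w₂ ∧
    CritTauPair A s t M v v'

/-- A type β transformation (in an Artin–Tits group): a type β transformation relative to some
dihedral standard parabolic subgroup (a pair of generators with finite label). -/
def StepBeta (A : ArtinData S) (w w' : Word S) : Prop :=
  ∃ (s t : S) (M : ℕ), s ≠ t ∧ A.m s t = (M : ℕ∞) ∧ StepBetaPair A s t M w w'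

/-! ### Restriction, direct products, Coxeter graph notions -/

/-- The Artin–Tits presentation induced on a subset `T` of the generators (the presentation of
the standard parabolic subgroup `A_T`). -/
def ArtinData.restrict (A : ArtinData S) (T : Set S) : ArtinData T where
  m a b := A.m a b
  symm a b := A.symm a b
  two_le a b h := A.two_le a b fun h' => h (Subtype.ext h')

/-- The Artin–Tits presentation on the disjoint union `S₁ ⊕ S₂` obtained from presentations on
`S₁` and `S₂` by adding the commuting relations `s₁s₂ = s₂s₁` (label `2`) for `s₁ ∈ S₁`,
`s₂ ∈ S₂`. -/
def prodData {S₁ S₂ : Type*} (A₁ : ArtinData S₁) (A₂ : ArtinData S₂) :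
    ArtinData (S₁ ⊕ S₂) where
  m x y :=
    match x, y with
    | Sum.inl a, Sum.inl b => A₁.m a b
    | Sum.inr a, Sum.inr b => A₂.m a b
    | _, _ => 2
  symm x y := by
    cases x <;> cases y
    · exact A₁.symm _ _
    · rfl
    · rfl
    · exact A₂.symm _ _
  two_le x y h := by
    cases x <;> cases y
    · exact A₁.two_le _ _ fun h' => h (congrArg Sum.inl h')
    · exact le_rfl
    · exact le_rfl
    · exact A₂.two_le _ _ fun h' => h (congrArg Sum.inr h')

/-- Adjacency in the Coxeter graph `Γ` restricted to `T`: distinct vertices of `T` joined by an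
edge (i.e. with label `≠ 2`, edges labelled `2` being removed in `Γ`). -/
def coxAdj (A : ArtinData S) (T : Set S) (x y : S) : Prop :=
  x ∈ T ∧ y ∈ T ∧ x ≠ y ∧ A.m x y ≠ 2

/-- The full subgraph of the Coxeter graph on the vertex subset `T` is connected. -/
def CoxConnected (A : ArtinData S) (T : Set S) : Prop :=
  ∀ x ∈ T, ∀ y ∈ T, Relation.ReflTransGen (coxAdj A T) x y

/-- The relator set of the Coxeter presentation on `T`: the Artin relations together with the
squares of the generators. -/
def coxRels (A : ArtinData S) (T : Set S) : Set (FreeGroup T) :=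
  rels (A.restrict T) ∪ {g | ∃ x : T, g = FreeGroup.of x * FreeGroup.of x}

/-- The induced presentation on `T` is of spherical type: its Coxeter group is finite. -/
def SphericalType (A : ArtinData S) (T : Set S) : Prop :=
  Finite (PresentedGroup (coxRels A T))

/-- The induced presentation on `T` is of large type: all labels are `≥ 3` (possibly `∞`). -/
def LargeTypeOn (A : ArtinData S) (T : Set S) : Prop :=
  ∀ x ∈ T, ∀ y ∈ T, x ≠ y → 3 ≤ A.m x y

/-! ### A model for dihedral Artin–Tits groups

The group `⟨c, f ∣ f² = 1, c ^ M central⟩` contains the dihedral Artin–Tits group with label `M`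
(`M = 0` encoding the label `∞`) as the subgroup generated by `f * c` and `c * f`. We describe
it by its action on normal forms. -/

/-- Normal forms `c ^ a₀ f c ^ a₁ f ⋯ c ^ aₖ f ^ ε` modulo `c ^ M`, together with the total
exponent of `c`. -/
@[ext] structure DState (M : ℕ) where
  top : ZMod M
  rest : List {a : ZMod M // a ≠ 0}
  flip : Bool
  deg : ℤ

namespace DState

variable {M : ℕ}

/-- The state of the identity element. -/
def base (M : ℕ) (b : Bool) : DState M := ⟨0, [], b, 0⟩

/-- The residues of the exponents of `c`. -/
def entries (φ : DState M) : List (ZMod M) := φ.top :: φ.rest.map Subtype.val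

/-- Left multiplication by `c`. -/
def C (M : ℕ) : Equiv.Perm (DState M) where
  toFun φ := ⟨φ.top + 1, φ.rest, φ.flip, φ.deg + 1⟩
  invFun φ := ⟨φ.top - 1, φ.rest, φ.flip, φ.deg - 1⟩
  left_inv φ := by ext <;> simp
  right_inv φ := by ext <;> simp

/-- Left multiplication by `f`, as a function. -/
noncomputable def flipFun (φ : DState M) : DState M :=
  if h : φ.top = 0 then
    match φ.rest with
    | [] => ⟨0, [], !φ.flip, φ.deg⟩
    | b :: r => ⟨b, r, φ.flip, φ.deg⟩
  else ⟨0, ⟨φ.top, h⟩ :: φ.rest, φ.flip, φ.deg⟩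

theorem flipFun_flipFun (φ : DState M) : flipFun (flipFun φ) = φ := by
  obtain ⟨a, rest, b, d⟩ := φ
  by_cases h : a = 0
  · subst h
    cases rest with
    | nil => simp [flipFun]
    | cons x r => simp [flipFun, x.2]
  · simp [flipFun, h]

/-- Left multiplication by `f`. -/
noncomputable def F (M : ℕ) : Equiv.Perm (DState M) where
  toFun := flipFun
  invFun := flipFun
  left_inv := flipFun_flipFun
  right_inv := flipFun_flipFun

theorem F_mul_F : F M * F M = 1 := Equiv.ext flipFun_flipFun

theorem F_inv : (F M)⁻¹ = F M := inv_eq_of_mul_eq_one_left F_mul_F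

theorem C_pow_apply (k : ℕ) (φ : DState M) :
    (C M ^ k) φ = ⟨φ.top + k, φ.rest, φ.flip, φ.deg + k⟩ := by
  induction k generalizing φ with
  | zero => simp
  | succ k ih =>
    rw [pow_succ, Equiv.Perm.mul_apply, ih]
    ext <;> simp [C] <;> ring

theorem C_pow_mul_F : C M ^ M * F M = F M * C M ^ M := by
  ext1 φ
  rw [Equiv.Perm.mul_apply, Equiv.Perm.mul_apply, C_pow_apply, C_pow_apply]
  obtain ⟨a, rest, b, d⟩ := φ
  by_cases h : a = 0
  · subst h
    cases rest <;> simp [F, flipFun]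
  · simp [F, flipFun, h]

/-- The integer list `n` lifts the exponents of the state `φ`, with the right total exponent. -/
def IsLift (n : List ℤ) (φ : DState M) : Prop :=
  n.map (Int.cast : ℤ → ZMod M) = φ.entries ∧ n.sum = φ.deg

/-- The cost of an integer list: the sum of the absolute values. -/
def cost (n : List ℤ) : ℕ := (n.map Int.natAbs).sum

@[simp] theorem cost_nil : cost [] = 0 := rfl

@[simp] theorem cost_cons (a : ℤ) (n : List ℤ) : cost (a :: n) = a.natAbs + cost n := by
  simp [cost]

theorem natAbs_sum_le_cost (n : List ℤ) : n.sum.natAbs ≤ cost n := by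
  induction n with
  | nil => simp
  | cons a n ih => simp only [List.sum_cons, cost_cons]; omega

/-- The minimal cost of a lift. -/
noncomputable def len (φ : DState M) : ℕ := sInf {k | ∃ n, IsLift n φ ∧ cost n = k}

theorem len_le {n : List ℤ} {φ : DState M} (h : IsLift n φ) : len φ ≤ cost n :=
  Nat.sInf_le ⟨n, h, rfl⟩

theorem exists_cost_eq_len {φ : DState M} (h : ∃ n, IsLift n φ) :
    ∃ n, IsLift n φ ∧ cost n = len φ := by
  obtain ⟨n, hn⟩ := h
  exact Nat.sInf_mem (s := {k | ∃ n, IsLift n φ ∧ cost n = k}) ⟨_, n, hn, rfl⟩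

theorem natAbs_deg_le_len {φ : DState M} (h : ∃ n, IsLift n φ) : φ.deg.natAbs ≤ len φ := by
  obtain ⟨n, hn, hc⟩ := exists_cost_eq_len h
  rw [← hc, ← hn.2]
  exact natAbs_sum_le_cost n

theorem IsLift.exists_cons {n : List ℤ} {φ : DState M} (h : IsLift n φ) :
    ∃ a l, n = a :: l ∧ (a : ZMod M) = φ.top ∧
      l.map (Int.cast : ℤ → ZMod M) = φ.rest.map Subtype.val ∧ a + l.sum = φ.deg := by
  obtain ⟨h1, h2⟩ := h
  cases n with
  | nil => simp [entries] at h1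
  | cons a l =>
    simp only [entries, List.map_cons, List.cons.injEq] at h1
    exact ⟨a, l, rfl, h1.1, h1.2, by simpa using h2⟩

theorem isLift_cons {a : ℤ} {l : List ℤ} {φ : DState M} :
    IsLift (a :: l) φ ↔ (a : ZMod M) = φ.top ∧
      l.map (Int.cast : ℤ → ZMod M) = φ.rest.map Subtype.val ∧ a + l.sum = φ.deg := by
  simp [IsLift, entries, and_assoc]

/-- `C ^ e` on lifts. -/
theorem isLift_C {a : ℤ} {l : List ℤ} {φ : DState M} :
    IsLift ((a + 1) :: l) (C M φ) ↔ IsLift (a :: l) φ := by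
  simp only [isLift_cons, C, Equiv.coe_fn_mk]
  push_cast
  constructor
  · rintro ⟨h1, h2, h3⟩; exact ⟨by simpa using h1, h2, by omega⟩
  · rintro ⟨h1, h2, h3⟩; exact ⟨by simpa using h1, h2, by omega⟩

theorem isLift_C_inv {a : ℤ} {l : List ℤ} {φ : DState M} :
    IsLift ((a - 1) :: l) ((C M)⁻¹ φ) ↔ IsLift (a :: l) φ := by
  have := isLift_C (a := a - 1) (l := l) (φ := (C M)⁻¹ φ)
  rw [show (C M) ((C M)⁻¹ φ) = φ from (C M).apply_symm_apply φ] at this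
  simpa using this.symm

/-- Every lift of a state yields a lift of its flip, of no bigger cost. -/
theorem exists_isLift_F {n : List ℤ} {φ : DState M} (h : IsLift n φ) :
    (φ.top ≠ 0 ∧ IsLift (0 :: n) (F M φ)) ∨
    (φ.top = 0 ∧ ∃ a b l, n = a :: b :: l ∧ (F M φ).flip = φ.flip ∧
      IsLift ((a + b) :: l) (F M φ)) ∨
    (φ.top = 0 ∧ ∃ a, n = [a] ∧ (F M φ).flip = (!φ.flip) ∧ IsLift n (F M φ)) := by
  obtain ⟨a, l, rfl, h1, h2, h3⟩ := h.exists_cons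
  obtain ⟨t, rest, β, d⟩ := φ
  by_cases ht : t = 0
  · subst ht
    right
    cases rest with
    | nil =>
      right
      obtain rfl : l = [] := by simpa using h2
      refine ⟨rfl, a, rfl, by simp [F, flipFun], ?_⟩
      rw [isLift_cons]
      simp_all [F, flipFun]
    | cons x r =>
      left
      cases l with
      | nil => simp at h2
      | cons b l =>
        refine ⟨rfl, a, b, l, rfl, by simp [F, flipFun], ?_⟩
        rw [isLift_cons]
        simp only [List.map_cons, List.cons.injEq, List.sum_cons] at h2 h3
        simp_all [F, flipFun, add_assoc]
  · left
    refine ⟨ht, ?_⟩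
    rw [isLift_cons]
    simp_all [F, flipFun]

theorem F_flip_of_ne {φ : DState M} (h : φ.top ≠ 0) : (F M φ).flip = φ.flip := by
  simp [F, flipFun, h]

theorem exists_isLift_F_le {n : List ℤ} {φ : DState M} (h : IsLift n φ) :
    ∃ n', IsLift n' (F M φ) ∧ cost n' ≤ cost n := by
  rcases exists_isLift_F h with ⟨-, h⟩ | ⟨-, a, b, l, rfl, -, h⟩ | ⟨-, a, rfl, -, h⟩
  · exact ⟨_, h, by simp⟩
  · refine ⟨_, h, ?_⟩
    simp only [cost_cons]; omega
  · exact ⟨_, h, le_rfl⟩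

theorem F_F (φ : DState M) : F M (F M φ) = φ := flipFun_flipFun φ

theorem len_F_le {φ : DState M} (h : ∃ n, IsLift n φ) : len (F M φ) ≤ len φ := by
  obtain ⟨n, hn, hc⟩ := exists_cost_eq_len h
  obtain ⟨n', hn', hc'⟩ := exists_isLift_F_le hn
  exact (len_le hn').trans (hc'.trans hc.le)

theorem Lifts.F {φ : DState M} (h : ∃ n, IsLift n φ) : ∃ n, IsLift n (F M φ) := by
  obtain ⟨n, hn⟩ := h
  obtain ⟨n', hn', -⟩ := exists_isLift_F_le hn
  exact ⟨n', hn'⟩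

theorem Lifts.C {φ : DState M} (h : ∃ n, IsLift n φ) : ∃ n, IsLift n (C M φ) := by
  obtain ⟨n, hn⟩ := h
  obtain ⟨a, l, rfl, -⟩ := hn.exists_cons
  exact ⟨_, isLift_C.2 hn⟩

theorem Lifts.C_inv {φ : DState M} (h : ∃ n, IsLift n φ) : ∃ n, IsLift n ((DState.C M)⁻¹ φ) := by
  obtain ⟨n, hn⟩ := h
  obtain ⟨a, l, rfl, -⟩ := hn.exists_cons
  exact ⟨_, isLift_C_inv.2 hn⟩

theorem len_F {φ : DState M} (h : ∃ n, IsLift n φ) : len (F M φ) = len φ := by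
  refine le_antisymm (len_F_le h) ?_
  have := len_F_le (Lifts.F h)
  rwa [F_F] at this

theorem len_C_le {φ : DState M} (h : ∃ n, IsLift n φ) : len (C M φ) ≤ len φ + 1 := by
  obtain ⟨n, hn, hc⟩ := exists_cost_eq_len h
  obtain ⟨a, l, rfl, -⟩ := hn.exists_cons
  have := len_le (isLift_C.2 hn)
  simp only [cost_cons] at *
  omega

theorem len_C_inv_le {φ : DState M} (h : ∃ n, IsLift n φ) :
    len ((C M)⁻¹ φ) ≤ len φ + 1 := by
  obtain ⟨n, hn, hc⟩ := exists_cost_eq_len h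
  obtain ⟨a, l, rfl, -⟩ := hn.exists_cons
  have := len_le (isLift_C_inv.2 hn)
  simp only [cost_cons] at *
  omega

theorem deg_C (φ : DState M) : (C M φ).deg = φ.deg + 1 := rfl

theorem deg_C_inv (φ : DState M) : ((C M)⁻¹ φ).deg = φ.deg - 1 := rfl

theorem deg_F (φ : DState M) : (F M φ).deg = φ.deg := by
  obtain ⟨a, rest, b, d⟩ := φ
  by_cases h : a = 0
  · subst h
    cases rest <;> simp [F, flipFun]
  · simp [F, flipFun, h]

theorem top_F {φ : DState M} (h : φ.top ≠ 0) : (F M φ).top = 0 := by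
  simp [F, flipFun, h]

/-- Moving multiples of `M` into the first entry of a list does not increase the cost, if this
entry is a negative multiple of `M`; minimality forces all the other entries to be
nonpositive. -/
theorem all_nonpos_of_minimal {a : ℤ} (ha : (a : ZMod M) = 0) (ha' : a < 0) (l : List ℤ)
    (hmin : ∀ n' : List ℤ, n'.map (Int.cast : ℤ → ZMod M) = (a :: l).map Int.cast →
      n'.sum = (a :: l).sum → cost (a :: l) ≤ cost n') : ∀ x ∈ l, x ≤ 0 := by
  intro x hx
  by_contra hpos
  obtain ⟨l₁, l₂, rfl⟩ := List.append_of_mem hx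
  have hdvd : (M : ℤ) ∣ a := (ZMod.intCast_zmod_eq_zero_iff_dvd a M).1 ha
  have hM : (0 : ℤ) < M := by
    rcases Nat.eq_zero_or_pos M with rfl | h
    · simp at hdvd; omega
    · exact_mod_cast h
  have hle : a ≤ -M := by
    have := Int.le_of_dvd (by omega) ((dvd_neg (a := (M : ℤ)) (b := a)).2 hdvd)
    omega
  have := hmin ((a + M) :: (l₁ ++ (x - M) :: l₂)) (by simp) (by simp; ring)
  have e : ∀ y, cost (l₁ ++ y :: l₂) = cost l₁ + y.natAbs + cost l₂ := by
    intro y; simp [cost, add_assoc]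
  simp only [cost_cons, e] at this
  omega

theorem cost_eq_of_nonpos {l : List ℤ} (h : ∀ x ∈ l, x ≤ 0) : (cost l : ℤ) = -l.sum := by
  induction l with
  | nil => simp
  | cons a l ih =>
    have h1 := h a (by simp)
    have h2 := ih fun x hx => h x (by simp [hx])
    simp only [cost_cons, List.sum_cons]
    omega

theorem cost_neg (l : List ℤ) : cost (l.map Neg.neg) = cost l := by
  induction l with
  | nil => simp
  | cons a l ih => simp [ih]

theorem sum_neg' (l : List ℤ) : (l.map Neg.neg).sum = -l.sum := by
  induction l with
  | nil => simp
  | cons a l ih => simp [ih]; ring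

/-- If the current entry is trivial and increasing it decreases the length, then the element is
negative. -/
theorem len_eq_neg_deg {φ : DState M} (h : ∃ n, IsLift n φ) (htop : φ.top = 0)
    (hlt : len (C M φ) < len φ) : (len φ : ℤ) = -φ.deg := by
  obtain ⟨n, hn, hc⟩ := exists_cost_eq_len (Lifts.C h)
  obtain ⟨a, l, rfl, -⟩ := hn.exists_cons
  have hn' : IsLift ((a - 1) :: l) φ := by
    rw [← isLift_C]; simpa using hn
  have h1 := len_le hn'
  simp only [cost_cons] at h1 hc
  have ha : a - 1 < 0 ∧ len φ = cost ((a - 1) :: l) := by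
    simp only [cost_cons]; omega
  have hz : ((a - 1 : ℤ) : ZMod M) = 0 := by rw [(isLift_cons.1 hn').1, htop]
  have := all_nonpos_of_minimal hz ha.1 l fun n' h1 h2 => by
    rw [← ha.2]; exact len_le ⟨h1.trans hn'.1, h2.trans hn'.2⟩
  rw [ha.2, cost_eq_of_nonpos (l := (a - 1) :: l), hn'.2]
  simpa using ⟨by omega, this⟩

/-- If the current entry is trivial and decreasing it decreases the length, then the element is
positive. -/
theorem len_eq_deg {φ : DState M} (h : ∃ n, IsLift n φ) (htop : φ.top = 0)
    (hlt : len ((C M)⁻¹ φ) < len φ) : (len φ : ℤ) = φ.deg := by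
  obtain ⟨n, hn, hc⟩ := exists_cost_eq_len (Lifts.C_inv h)
  obtain ⟨a, l, rfl, -⟩ := hn.exists_cons
  have hn' : IsLift ((a + 1) :: l) φ := by
    rw [← isLift_C_inv]; simpa using hn
  have h1 := len_le hn'
  simp only [cost_cons] at h1 hc
  have ha : -(a + 1) < 0 ∧ len φ = cost ((a + 1) :: l) := by
    simp only [cost_cons]; omega
  have hz : ((-(a + 1) : ℤ) : ZMod M) = 0 := by
    rw [Int.cast_neg, (isLift_cons.1 hn').1, htop, neg_zero]
  have hnn : ∀ l : List ℤ, (l.map Neg.neg).map Neg.neg = l := by intro l; simp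
  have := all_nonpos_of_minimal hz ha.1 (l.map Neg.neg) fun n' h1 h2 => by
    rw [← cost_neg n', ← List.map_cons, cost_neg, ← ha.2]
    refine len_le ⟨Eq.trans ?_ hn'.1, Eq.trans ?_ hn'.2⟩
    · have := congrArg (List.map (Neg.neg : ZMod M → ZMod M)) h1
      simpa [Function.comp_def] using this
    · rw [sum_neg', h2, ← List.map_cons, sum_neg', neg_neg]
  have h3 := cost_eq_of_nonpos (l := ((a + 1) :: l).map Neg.neg) (by
    simpa using ⟨by omega, by simpa using this⟩)
  rw [cost_neg, sum_neg', neg_neg, hn'.2] at h3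
  rw [ha.2, h3]

/-- `f * c` and its inverse do not both decrease the length. -/
theorem not_len_lt_and_len_lt {φ : DState M} (h : ∃ n, IsLift n φ) :
    ¬ (len (C M φ) < len φ ∧ len ((C M)⁻¹ (F M φ)) < len φ) := by
  rintro ⟨h1, h2⟩
  by_cases ht : φ.top = 0
  · have h3 := len_eq_neg_deg h ht h1
    have h4 := natAbs_deg_le_len (Lifts.C_inv (Lifts.F h))
    rw [deg_C_inv, deg_F] at h4
    omega
  · rw [← len_F h] at h2
    have h3 := len_eq_deg (Lifts.F h) (top_F ht) h2
    have h4 := natAbs_deg_le_len (Lifts.C h)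
    rw [deg_C] at h4
    rw [deg_F, len_F h] at h3
    omega

/-- A state of positive length has a shorter neighbour. -/
theorem exists_len_lt {φ : DState M} (h : ∃ n, IsLift n φ) (hpos : 0 < len φ) :
    len (C M φ) < len φ ∨ len ((C M)⁻¹ φ) < len φ ∨
      len (C M (F M φ)) < len φ ∨ len ((C M)⁻¹ (F M φ)) < len φ := by
  have key : ∀ ψ : DState M, (∃ n, IsLift n ψ) →
      (∃ a l, IsLift (a :: l) ψ ∧ cost (a :: l) = len ψ ∧ a ≠ 0) →
      len (C M ψ) < len ψ ∨ len ((C M)⁻¹ ψ) < len ψ := by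
    rintro ψ hψ ⟨a, l, hl, hc, ha⟩
    have h1 := len_le (isLift_C.2 hl)
    have h2 := len_le (isLift_C_inv.2 hl)
    simp only [cost_cons] at *
    omega
  obtain ⟨n, hn, hc⟩ := exists_cost_eq_len h
  obtain ⟨a, l, rfl, h1, h2, h3⟩ := hn.exists_cons
  by_cases ha : a = 0
  · subst ha
    have ht : φ.top = 0 := by simpa using h1.symm
    rcases exists_isLift_F hn with ⟨h', -⟩ | ⟨-, a, b, l', heq, -, hb⟩ | ⟨-, a, heq, -, -⟩
    · exact (h' ht).elim
    · obtain ⟨rfl, rfl⟩ : 0 = a ∧ l = b :: l' := by simpa using heq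
      have := key (F M φ) (Lifts.F h) ⟨_, _, hb, by
        rw [len_F h, ← hc]; simp, by
        intro hb0
        have hb0 : b = 0 := by simpa using hb0
        obtain ⟨t, rest, β, d⟩ := φ
        cases rest with
        | nil => simp at h2
        | cons x r =>
          simp only [List.map_cons, List.cons.injEq, hb0] at h2
          exact x.2 (by simpa using h2.1.symm)⟩
      rw [len_F h] at this
      tauto
    · obtain ⟨rfl, rfl⟩ : 0 = a ∧ l = [] := by simpa using heq
      simp at hc; omega
  · have := key φ h ⟨_, _, hn, hc, ha⟩
    tauto

theorem eq_base_of_len_eq_zero {φ : DState M} (h : ∃ n, IsLift n φ) (h0 : len φ = 0) :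
    φ = base M φ.flip := by
  obtain ⟨n, hn, hc⟩ := exists_cost_eq_len h
  obtain ⟨a, l, rfl, h1, h2, h3⟩ := hn.exists_cons
  rw [h0, cost_cons] at hc
  obtain rfl : a = 0 := by omega
  obtain ⟨t, rest, β, d⟩ := φ
  cases rest with
  | nil =>
    obtain rfl : l = [] := by simpa using h2
    ext <;> simp_all [base]
  | cons x r =>
    exfalso
    cases l with
    | nil => simp at h2
    | cons b l =>
      simp only [List.map_cons, List.cons.injEq] at h2
      have : b = 0 := by simp only [cost_cons] at hc; omega
      exact x.2 (by simpa [this] using h2.1.symm)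

end DState

/-! ### Words in a dihedral Artin–Tits group -/

@[simp] theorem wbar_nil (A : ArtinData S) : wbar A [] = 1 := rfl

theorem wbar_append (A : ArtinData S) (u v : Word S) : wbar A (u ++ v) = wbar A u * wbar A v := by
  simp [wbar, ← FreeGroup.mul_mk]

theorem wbar_singleton_not (A : ArtinData S) (x : S) (b : Bool) :
    wbar A [(x, !b)] = (wbar A [(x, b)])⁻¹ := by
  rw [wbar, wbar, ← map_inv, FreeGroup.inv_mk]
  rfl

theorem wbar_wordInv (A : ArtinData S) (u : Word S) : wbar A (wordInv u) = (wbar A u)⁻¹ := by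
  rw [wbar, wbar, ← map_inv, FreeGroup.inv_mk, wordInv, FreeGroup.invRev, List.map_reverse]

theorem wbar_eq_of_isRel {A : ArtinData S} {u v : Word S} (h : IsRel A u v) :
    wbar A u = wbar A v := by
  rw [← mul_inv_eq_one]
  have := PresentedGroup.one_of_mem (rels := rels A) ⟨u, v, h, rfl⟩
  rwa [map_mul, map_inv] at this

/-- The hom out of an Artin–Tits group defined by images of the generators. -/
theorem exists_hom (A : ArtinData S) {P : Type*} [Group P] (g : S → P)
    (hg : ∀ u v, IsRel A u v → (u.map fun a => cond a.2 (g a.1) (g a.1)⁻¹).prod =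
      (v.map fun a => cond a.2 (g a.1) (g a.1)⁻¹).prod) :
    ∃ h : ArtinGroup A →* P, ∀ w : Word S,
      h (wbar A w) = (w.map fun a => cond a.2 (g a.1) (g a.1)⁻¹).prod := by
  have key : ∀ r ∈ rels A, FreeGroup.lift g r = 1 := by
    rintro r ⟨u, v, huv, rfl⟩
    rw [map_mul, map_inv, FreeGroup.lift_mk, FreeGroup.lift_mk, mul_inv_eq_one]
    exact hg u v huv
  refine ⟨PresentedGroup.toGroup key, fun w => ?_⟩
  rw [wbar, ← FreeGroup.lift_mk]
  rfl

theorem length_altWord (x y : S) (k : ℕ) : (altWord x y k).length = k := by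
  induction k generalizing x y with
  | zero => rfl
  | succ k ih => simp [altWord, ih]

/-- Words representing the same element have lengths of the same parity. -/
theorem length_parity {A : ArtinData S} {u v : Word S} (h : wbar A u = wbar A v) :
    u.length % 2 = v.length % 2 := by
  obtain ⟨φ, hφ⟩ := exists_hom A (P := Multiplicative (ZMod 2)) (fun _ => .ofAdd 1) (by
    rintro u v ⟨s, t, k, -, -, rfl, rfl⟩
    have : ∀ a : S × Bool, (cond a.2 (Multiplicative.ofAdd (1 : ZMod 2)) (.ofAdd 1)⁻¹) =
        Multiplicative.ofAdd (1 : ZMod 2) := by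
      rintro ⟨a, _ | _⟩ <;> rfl
    simp only [this, List.map_const', List.prod_replicate, length_altWord])
  have e := congrArg φ h
  have : ∀ a : S × Bool, (cond a.2 (Multiplicative.ofAdd (1 : ZMod 2)) (.ofAdd 1)⁻¹) =
      Multiplicative.ofAdd (1 : ZMod 2) := by
    rintro ⟨a, _ | _⟩ <;> rfl
  simp only [hφ, this, List.map_const', List.prod_replicate, ← ofAdd_nsmul,
    EmbeddingLike.apply_eq_iff_eq, nsmul_eq_mul, mul_one] at e
  exact (ZMod.natCast_eq_natCast_iff' _ _ _).1 e

/-- The presentation keeping only the relations between generators in `T`. -/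
noncomputable def ArtinData.on (A : ArtinData S) (T : Set S) : ArtinData S where
  m a b := if a ∈ T ∧ b ∈ T then A.m a b else ⊤
  symm a b := by simp only [A.symm a b, and_comm]
  two_le a b h := by
    split_ifs
    · exact A.two_le a b h
    · exact le_top

theorem IsRel.of_on {A : ArtinData S} {T : Set S} {u v : Word S} (h : IsRel (A.on T) u v) :
    ∃ (s t : S) (k : ℕ), s ∈ T ∧ t ∈ T ∧ s ≠ t ∧ A.m s t = (k : ℕ∞) ∧
      u = altWord s t k ∧ v = altWord t s k := by
  obtain ⟨s, t, k, hst, hm, rfl, rfl⟩ := h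
  simp only [ArtinData.on] at hm
  split_ifs at hm with h
  · exact ⟨s, t, k, h.1, h.2, hst, hm, rfl, rfl⟩
  · simp at hm

/-- Equality in the subpresentation implies equality. -/
theorem wbar_eq_of_on {A : ArtinData S} {T : Set S} {u v : Word S}
    (h : wbar (A.on T) u = wbar (A.on T) v) : wbar A u = wbar A v := by
  have hw : ∀ w : Word S, (w.map fun a => cond a.2 (wbar A [(a.1, true)])
      (wbar A [(a.1, true)])⁻¹).prod = wbar A w := by
    intro w
    induction w with
    | nil => rfl
    | cons a w ih =>
      have e : wbar A (a :: w) = wbar A [a] * wbar A w := wbar_append A [a] w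
      rw [List.map_cons, List.prod_cons, ih, e]
      obtain ⟨x, _ | _⟩ := a
      · exact congrArg (· * wbar A w) (wbar_singleton_not A x true).symm
      · rfl
  obtain ⟨φ, hφ⟩ := exists_hom (A.on T) (P := ArtinGroup A) (fun x => wbar A [(x, true)]) (by
    intro u v huv
    obtain ⟨s, t, k, -, -, hst, hm, rfl, rfl⟩ := huv.of_on
    rw [hw, hw]
    exact wbar_eq_of_isRel ⟨s, t, k, hst, hm, rfl, rfl⟩)
  have := congrArg φ h
  rwa [hφ, hφ, hw, hw] at this

/-- Geodesic words over `T` for the subpresentation on `T`. -/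
abbrev Geo (A : ArtinData S) (T : Set S) (u : Word S) : Prop := GeodesicOver (A.on T) T u

theorem wordOver_append {T : Set S} {u v : Word S} :
    WordOver T (u ++ v) ↔ WordOver T u ∧ WordOver T v := by
  simp only [WordOver, List.mem_append]
  exact ⟨fun h => ⟨fun l hl => h l (.inl hl), fun l hl => h l (.inr hl)⟩,
    fun h l hl => hl.elim (h.1 l) (h.2 l)⟩

@[simp] theorem wordOver_singleton {T : Set S} {a : S × Bool} : WordOver T [a] ↔ a.1 ∈ T := by
  simp [WordOver]

@[simp] theorem wordOver_nil {T : Set S} : WordOver T [] := by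
  simp [WordOver]

/-! ### States of words -/

section State

/-- The image of a word under the map sending `s` to `c * f` and other generators to `f * c`. -/
noncomputable def dihProd {P : Type*} [Group P] (c f : P) (s : S) (w : Word S) : P :=
  (w.map fun a => cond a.2 (if a.1 = s then c * f else f * c)
    (if a.1 = s then c * f else f * c)⁻¹).prod

theorem dihProd_append {P : Type*} [Group P] (c f : P) (s : S) (u v : Word S) :
    dihProd c f s (u ++ v) = dihProd c f s u * dihProd c f s v := by
  simp [dihProd]

theorem dihProd_altWord {P : Type*} [Group P] {c f : P} (hf : f * f = 1) {s t : S} (hst : s ≠ t)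
    (k : ℕ) : dihProd c f s (altWord s t k) = c ^ k * f ^ k ∧
      dihProd c f s (altWord t s k) = f * c ^ k * f ^ (k + 1) := by
  induction k with
  | zero => simp [altWord, dihProd, hf]
  | succ k ih =>
    have h1 : altWord s t (k + 1) = [(s, true)] ++ altWord t s k := rfl
    have h2 : altWord t s (k + 1) = [(t, true)] ++ altWord s t k := rfl
    rw [h1, h2, dihProd_append, dihProd_append, ih.1, ih.2]
    have h3 : f ^ (k + 1 + 1) = f ^ k := by rw [pow_succ, pow_succ, mul_assoc, hf, mul_one]
    constructor
    · simp only [dihProd, List.map_cons, List.map_nil, List.prod_cons, List.prod_nil, cond_true,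
        if_true, mul_one]
      rw [pow_succ' c, mul_assoc c f, ← mul_assoc f, ← mul_assoc f, hf, one_mul, mul_assoc]
    · simp only [dihProd, List.map_cons, List.map_nil, List.prod_cons, List.prod_nil, cond_true,
        if_neg hst.symm, mul_one, h3]
      rw [pow_succ' c]
      simp only [mul_assoc]

/-- The label of `s, t`, with `0` encoding `∞`. -/
noncomputable abbrev lab (A : ArtinData S) (s t : S) : ℕ := (A.m s t).toNat

theorem dihProd_eq {A : ArtinData S} {P : Type*} [Group P] {c f : P} {s t : S} (hst : s ≠ t)
    (hf : f * f = 1) (hc : c ^ lab A s t * f = f * c ^ lab A s t) {u v : Word S}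
    (h : wbar (A.on {s, t}) u = wbar (A.on {s, t}) v) : dihProd c f s u = dihProd c f s v := by
  obtain ⟨φ, hφ⟩ := exists_hom (A.on {s, t}) (fun x => if x = s then c * f else f * c) (by
    intro u v huv
    obtain ⟨x, y, k, hx, hy, hxy, hm, rfl, rfl⟩ := huv.of_on
    change dihProd c f s _ = dihProd c f s _
    have key : A.m s t = k → dihProd c f s (altWord s t k) = dihProd c f s (altWord t s k) := by
      intro hm
      simp only [lab, hm, ENat.toNat_natCast] at hc
      rw [(dihProd_altWord hf hst k).1, (dihProd_altWord hf hst k).2, ← hc, pow_succ', mul_assoc,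
        ← mul_assoc f, hf, one_mul]
    rcases hx with rfl | rfl <;> rcases hy with rfl | rfl
    · exact (hxy rfl).elim
    · exact key hm
    · exact (key (by rw [A.symm]; exact hm)).symm
    · exact (hxy rfl).elim)
  have := congrArg φ h
  rwa [hφ, hφ] at this

/-- The state of a word over `{s, t}`. -/
noncomputable def state (M : ℕ) (s : S) (w : Word S) : DState M :=
  (dihProd (DState.C M)⁻¹ (DState.F M) s w)⁻¹ (DState.base M false)

theorem state_eq {A : ArtinData S} {s t : S} (hst : s ≠ t) {u v : Word S}
    (h : wbar (A.on {s, t}) u = wbar (A.on {s, t}) v) :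
    state (lab A s t) s u = state (lab A s t) s v := by
  rw [state, state, dihProd_eq hst DState.F_mul_F _ h]
  rw [inv_pow, inv_mul_eq_iff_eq_mul, ← mul_assoc, DState.C_pow_mul_F, mul_inv_cancel_right]

open DState

theorem state_append (M : ℕ) (s : S) (w : Word S) (a : S × Bool) :
    state M s (w ++ [a]) = (dihProd (C M)⁻¹ (F M) s [a])⁻¹ (state M s w) := by
  rw [state, dihProd_append, mul_inv_rev, Equiv.Perm.mul_apply, state]

theorem state_append_self (M : ℕ) (s : S) (w : Word S) :
    state M s (w ++ [(s, true)]) = F M (C M (state M s w)) := by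
  rw [state_append, ← Equiv.Perm.mul_apply]
  simp [dihProd, F_inv]

theorem state_append_self_inv (M : ℕ) (s : S) (w : Word S) :
    state M s (w ++ [(s, false)]) = (C M)⁻¹ (F M (state M s w)) := by
  rw [state_append, ← Equiv.Perm.mul_apply]
  simp [dihProd]

theorem state_append_other (M : ℕ) {s t : S} (h : t ≠ s) (w : Word S) :
    state M s (w ++ [(t, true)]) = C M (F M (state M s w)) := by
  rw [state_append, ← Equiv.Perm.mul_apply]
  simp [dihProd, F_inv, h]

theorem state_append_other_inv (M : ℕ) {s t : S} (h : t ≠ s) (w : Word S) :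
    state M s (w ++ [(t, false)]) = F M ((C M)⁻¹ (state M s w)) := by
  rw [state_append, ← Equiv.Perm.mul_apply]
  simp [dihProd, h]

theorem state_nil (M : ℕ) (s : S) : state M s [] = base M false := by
  simp [state, dihProd]

theorem isLift_base (M : ℕ) (b : Bool) : IsLift [0] (base M b) := by
  simp [IsLift, base, entries]

theorem state_induction {M : ℕ} {s : S} {p : Word S → DState M → Prop}
    (h0 : p [] (base M false))
    (h1 : ∀ w φ, p w φ → p (w ++ [(s, true)]) (F M (C M φ)))
    (h2 : ∀ w φ, p w φ → p (w ++ [(s, false)]) ((C M)⁻¹ (F M φ)))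
    (h3 : ∀ w φ x, x ≠ s → p w φ → p (w ++ [(x, true)]) (C M (F M φ)))
    (h4 : ∀ w φ x, x ≠ s → p w φ → p (w ++ [(x, false)]) (F M ((C M)⁻¹ φ))) (w : Word S) :
    p w (state M s w) := by
  induction w using List.reverseRecOn with
  | nil => rwa [state_nil]
  | append_singleton w a ih =>
    obtain ⟨x, b⟩ := a
    by_cases hx : x = s
    · subst hx
      cases b
      · rw [state_append_self_inv]; exact h2 _ _ ih
      · rw [state_append_self]; exact h1 _ _ ih
    · cases b
      · rw [state_append_other_inv _ hx]; exact h4 _ _ _ hx ih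
      · rw [state_append_other _ hx]; exact h3 _ _ _ hx ih

theorem len_state_le (M : ℕ) (s : S) (w : Word S) :
    (∃ n, IsLift n (state M s w)) ∧ len (state M s w) ≤ w.length := by
  refine state_induction (p := fun w φ => (∃ n, IsLift n φ) ∧ len φ ≤ w.length) ?_ ?_ ?_ ?_ ?_ w
  · exact ⟨⟨_, isLift_base M false⟩, by simpa using len_le (isLift_base M false)⟩
  · rintro w φ ⟨h1, h2⟩
    refine ⟨Lifts.F (Lifts.C h1), ?_⟩
    rw [len_F (Lifts.C h1), List.length_append]
    exact (len_C_le h1).trans (by simpa using h2)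
  · rintro w φ ⟨h1, h2⟩
    refine ⟨Lifts.C_inv (Lifts.F h1), ?_⟩
    rw [List.length_append, ← len_F h1] at *
    exact (len_C_inv_le (Lifts.F h1)).trans (by simpa using h2)
  · rintro w φ x - ⟨h1, h2⟩
    refine ⟨Lifts.C (Lifts.F h1), ?_⟩
    rw [List.length_append, ← len_F h1] at *
    exact (len_C_le (Lifts.F h1)).trans (by simpa using h2)
  · rintro w φ x - ⟨h1, h2⟩
    refine ⟨Lifts.F (Lifts.C_inv h1), ?_⟩
    rw [len_F (Lifts.C_inv h1), List.length_append]
    exact (len_C_inv_le h1).trans (by simpa using h2)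

/-- The product `f c ^ n₁ f c ^ n₂ ⋯`. -/
def liftProd {P : Type*} [Group P] (c f : P) : List ℤ → P
  | [] => 1
  | n :: l => f * c ^ n * liftProd c f l

theorem commute_zpow {P : Type*} [Group P] {c f : P} {M : ℕ} (hc : c ^ M * f = f * c ^ M) {a : ℤ}
    (ha : (a : ZMod M) = 0) : c ^ a * f = f * c ^ a := by
  obtain ⟨k, rfl⟩ := (ZMod.intCast_zmod_eq_zero_iff_dvd a M).1 ha
  rw [zpow_mul, zpow_natCast]
  exact (Commute.zpow_left (show Commute (c ^ M) f from hc) k)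

/-- The state of a word determines its image in every group. -/
theorem exists_isLift_state {P : Type*} [Group P] {c f : P} {M : ℕ} (hf : f * f = 1)
    (hc : c ^ M * f = f * c ^ M) (s : S) (w : Word S) :
    ∃ n, IsLift n (state M s w) ∧ (dihProd c⁻¹ f s w)⁻¹ =
      f * liftProd c f n * (if (state M s w).flip then f else 1) := by
  have hfi : f⁻¹ = f := inv_eq_of_mul_eq_one_left hf
  have hff : ∀ x, f * (f * x) = x := fun x => by rw [← mul_assoc, hf, one_mul]
  have hC : ∀ (q : P) (φ : DState M), (∃ n, IsLift n φ ∧ q = f * liftProd c f n *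
      (if φ.flip then f else 1)) → ∃ n, IsLift n (C M φ) ∧ c * q = f * liftProd c f n *
      (if (C M φ).flip then f else 1) := by
    rintro _ φ ⟨n, hn, rfl⟩
    obtain ⟨a, l, rfl, -⟩ := hn.exists_cons
    refine ⟨_, isLift_C.2 hn, ?_⟩
    simp only [liftProd, mul_assoc, hff, add_comm a 1, zpow_one_add]
    rfl
  have hCi : ∀ (q : P) (φ : DState M), (∃ n, IsLift n φ ∧ q = f * liftProd c f n *
      (if φ.flip then f else 1)) → ∃ n, IsLift n ((C M)⁻¹ φ) ∧ c⁻¹ * q = f * liftProd c f n *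
      (if ((C M)⁻¹ φ).flip then f else 1) := by
    rintro _ φ ⟨n, hn, rfl⟩
    obtain ⟨a, l, rfl, -⟩ := hn.exists_cons
    refine ⟨_, isLift_C_inv.2 hn, ?_⟩
    have : c ^ (a - 1) = c⁻¹ * c ^ a := by rw [sub_eq_neg_add, zpow_add, zpow_neg_one]
    simp only [liftProd, mul_assoc, hff, this]
    rfl
  have hF : ∀ (q : P) (φ : DState M), (∃ n, IsLift n φ ∧ q = f * liftProd c f n *
      (if φ.flip then f else 1)) → ∃ n, IsLift n (F M φ) ∧ f * q = f * liftProd c f n *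
      (if (F M φ).flip then f else 1) := by
    rintro _ φ ⟨n, hn, rfl⟩
    have h0 := hn
    rcases exists_isLift_F hn with ⟨h, hl⟩ | ⟨h, a, b, l, rfl, he, hl⟩ | ⟨h, a, rfl, he, hl⟩
    · refine ⟨_, hl, ?_⟩
      rw [F_flip_of_ne h]
      simp only [liftProd, zpow_zero, mul_one, mul_assoc]
    · refine ⟨_, hl, ?_⟩
      have := commute_zpow hc ((isLift_cons.1 h0).1.trans h)
      rw [he]
      simp only [liftProd, mul_assoc, hff, zpow_add]
      rw [← mul_assoc (c ^ a) f, this, mul_assoc, hff]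
    · refine ⟨_, hl, ?_⟩
      have := commute_zpow hc ((isLift_cons.1 h0).1.trans h)
      rw [he]
      cases φ.flip <;> simp [liftProd, hff, this]
  refine state_induction (p := fun w φ => ∃ n, IsLift n φ ∧ (dihProd c⁻¹ f s w)⁻¹ =
      f * liftProd c f n * (if φ.flip then f else 1)) ?_ ?_ ?_ ?_ ?_ w
  · exact ⟨_, isLift_base M false, by simp [dihProd, liftProd, base, hf]⟩
  · intro w φ h
    convert hF _ _ (hC _ _ h) using 3
    simp [dihProd, mul_assoc, hfi]
  · intro w φ h
    convert hCi _ _ (hF _ _ h) using 3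
    simp [dihProd, mul_assoc]
  · intro w φ x hx h
    convert hC _ _ (hF _ _ h) using 3
    simp [dihProd, mul_assoc, hfi, hx]
  · intro w φ x hx h
    convert hF _ _ (hCi _ _ h) using 3
    simp [dihProd, mul_assoc, hx]

end State

section State

open DState

/-- Right multiplication by the inverse of one of two generators of a group, depending on a
boolean which is then flipped. -/
def sideShift {G : Type*} [Group G] (x : Bool → G) : Equiv.Perm (G × Bool) where
  toFun p := (p.1 * x p.2, !p.2)
  invFun p := (p.1 * (x !p.2)⁻¹, !p.2)
  left_inv p := by simp
  right_inv p := by simp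

/-- Flipping the boolean. -/
def sideFlip (G : Type*) : Equiv.Perm (G × Bool) where
  toFun p := (p.1, !p.2)
  invFun p := (p.1, !p.2)
  left_inv p := by simp
  right_inv p := by simp

theorem sideShift_pow {A : ArtinData S} (T : Set S) (x : Bool → S) (k : ℕ)
    (p : ArtinGroup (A.on T) × Bool) :
    (sideShift (fun b => wbar (A.on T) [(x b, true)]) ^ k) p =
      (p.1 * wbar (A.on T) (altWord (x p.2) (x !p.2) k), (Bool.not^[k]) p.2) := by
  induction k generalizing p with
  | zero => simp [altWord]
  | succ k ih =>
    have : altWord (x p.2) (x !p.2) (k + 1) = [(x p.2, true)] ++ altWord (x !p.2) (x p.2) k := rfl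
    rw [pow_succ, Equiv.Perm.mul_apply, ih, this, wbar_append]
    simp [sideShift, mul_assoc]

theorem wbar_eq_one_of_state {A : ArtinData S} {s t : S} (hst : s ≠ t) {w : Word S}
    (hw : WordOver {s, t} w) (h0 : len (state (lab A s t) s w) = 0) :
    wbar (A.on {s, t}) w = 1 := by
  set B := A.on {s, t} with hB
  set x : Bool → S := fun b => if b then t else s with hx
  set c := sideShift (fun b => wbar B [(x b, true)]) with hc
  set f := sideFlip (ArtinGroup B) with hf
  set M := lab A s t
  have hff : f * f = 1 := by ext1 p; simp [f, sideFlip]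
  have hbraid : wbar B (altWord s t M) = wbar B (altWord t s M) := by
    rcases Nat.eq_zero_or_pos M with h | h
    · rw [h]; rfl
    · refine wbar_eq_of_isRel ⟨s, t, M, hst, ?_, rfl, rfl⟩
      have : A.m s t ≠ ⊤ := by
        intro h'
        simp [M, lab, h'] at h
      simp [hB, ArtinData.on, M, lab, ENat.natCast_toNat this]
  have hcf : c ^ M * f = f * c ^ M := by
    ext1 p
    rw [Equiv.Perm.mul_apply, Equiv.Perm.mul_apply, hc, sideShift_pow, sideShift_pow]
    obtain ⟨g, b⟩ := p
    have : ∀ k (b : Bool), (Bool.not^[k]) (!b) = !(Bool.not^[k]) b := by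
      intro k b
      rw [← Function.iterate_succ_apply, Function.iterate_succ_apply']
    cases b
    · simpa [f, sideFlip, x] using ⟨hbraid.symm, this M false⟩
    · simpa [f, sideFlip, x] using ⟨hbraid, this M true⟩
  have hfi : f⁻¹ = f := inv_eq_of_mul_eq_one_left hff
  have hact : ∀ w : Word S, WordOver {s, t} w →
      (dihProd c⁻¹ f s w)⁻¹ (1, false) = (wbar B w, false) := by
    intro w
    induction w using List.reverseRecOn with
    | nil => intro _; simp [dihProd]
    | append_singleton w a ih =>
      intro h
      rw [wordOver_append] at h
      rw [dihProd_append, mul_inv_rev, Equiv.Perm.mul_apply, ih h.1, wbar_append]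
      obtain ⟨y, b⟩ := a
      obtain rfl | rfl : y = s ∨ y = t := by simpa using h.2
      · cases b
        · have := wbar_singleton_not B y true
          rw [Bool.not_true] at this
          rw [this]
          simp only [dihProd, List.map_cons, List.map_nil, List.prod_cons, List.prod_nil,
            cond_false, if_true, mul_one, inv_inv]
          simp only [hc, hf, Equiv.Perm.mul_apply]
          change ((sideShift _).symm (sideFlip _ _)) = _
          simp [sideShift, sideFlip, x]
        · simp [dihProd, hfi]
          simp [c, f, sideShift, sideFlip, x]
      · cases b
        · have := wbar_singleton_not B y true
          rw [Bool.not_true] at this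
          rw [this]
          simp only [dihProd, List.map_cons, List.map_nil, List.prod_cons, List.prod_nil,
            cond_false, if_neg hst.symm, mul_one, inv_inv]
          simp only [hc, hf, Equiv.Perm.mul_apply]
          change (sideFlip _ ((sideShift _).symm _)) = _
          simp [sideShift, sideFlip, x]
        · simp [dihProd, hfi, hst.symm]
          simp [c, f, sideShift, sideFlip, x]
  obtain ⟨n, hn, he⟩ := exists_isLift_state hff hcf s w
  have hb := eq_base_of_len_eq_zero (len_state_le M s w).1 h0
  rw [hb] at hn
  obtain ⟨a, l, rfl, h1, h2, h3⟩ := hn.exists_cons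
  obtain rfl : l = [] := by simpa [base] using h2
  obtain rfl : a = 0 := by simpa [base] using h3
  have := hact w hw
  rw [he] at this
  cases hflip : (state M s w).flip
  · simp [hflip, liftProd, hff] at this
    exact this.symm
  · simp [hflip, liftProd, hff] at this
    simp [f, sideFlip] at this

theorem exists_length_eq_len {A : ArtinData S} {s t : S} (hst : s ≠ t) (w : Word S)
    (hw : WordOver {s, t} w) :
    ∃ w', WordOver {s, t} w' ∧ wbar (A.on {s, t}) w' = wbar (A.on {s, t}) w ∧
      w'.length = len (state (lab A s t) s w) := by
  induction hk : len (state (lab A s t) s w) using Nat.strong_induction_on generalizing w with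
  | _ k ih =>
  rcases Nat.eq_zero_or_pos k with rfl | hpos
  · exact ⟨[], wordOver_nil, (wbar_eq_one_of_state hst hw hk).symm, rfl⟩
  have hL := (len_state_le (lab A s t) s w).1
  have step : ∀ x b, x = s ∨ x = t → len (state (lab A s t) s (w ++ [(x, b)])) < k →
      ∃ w', WordOver {s, t} w' ∧ wbar (A.on {s, t}) w' = wbar (A.on {s, t}) w ∧
      w'.length = k := by
    intro x b hx hlt
    obtain ⟨w', h1, h2, h3⟩ := ih _ hlt (w ++ [(x, b)])
      (wordOver_append.2 ⟨hw, by simpa using hx⟩) rfl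
    have e : wbar (A.on {s, t}) (w' ++ [(x, !b)]) = wbar (A.on {s, t}) w := by
      rw [wbar_append, h2, wbar_append, wbar_singleton_not, mul_inv_cancel_right]
    refine ⟨w' ++ [(x, !b)], wordOver_append.2 ⟨h1, by simpa using hx⟩, e, ?_⟩
    have := (len_state_le (lab A s t) s (w' ++ [(x, !b)])).2
    rw [state_eq hst e, hk] at this
    simp only [List.length_append, List.length_singleton] at this ⊢
    omega
  rcases exists_len_lt hL (by omega) with h | h | h | h <;> rw [hk] at h
  · exact step s true (.inl rfl) (by rwa [state_append_self, len_F (Lifts.C hL)])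
  · exact step t false (.inr rfl)
      (by rwa [state_append_other_inv _ hst.symm, len_F (Lifts.C_inv hL)])
  · exact step t true (.inr rfl) (by rwa [state_append_other _ hst.symm])
  · exact step s false (.inl rfl) (by rwa [state_append_self_inv])

theorem geo_iff {A : ArtinData S} {s t : S} (hst : s ≠ t) {w : Word S}
    (hw : WordOver {s, t} w) :
    Geo A {s, t} w ↔ w.length = len (state (lab A s t) s w) := by
  constructor
  · rintro ⟨-, h⟩
    obtain ⟨w', h1, h2, h3⟩ := exists_length_eq_len hst w hw
    exact le_antisymm ((h w' h1 h2).trans h3.le) (len_state_le _ _ _).2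
  · intro h
    refine ⟨hw, fun w' _ he => ?_⟩
    rw [h, ← state_eq hst he]
    exact (len_state_le _ _ _).2

/-- A geodesic over two generators has not two opposite last letters. -/
theorem Geo.not_both_signs {A : ArtinData S} {s t : S} (hst : s ≠ t) {u v : Word S}
    {x : S} {b : Bool} (hu : Geo A {s, t} (u ++ [(x, b)])) (hv : Geo A {s, t} (v ++ [(x, !b)]))
    (h : wbar (A.on {s, t}) (u ++ [(x, b)]) = wbar (A.on {s, t}) (v ++ [(x, !b)])) : False := by
  wlog hx : x = s generalizing s t
  · have hx' : x = t := by
      have := (wordOver_append.1 hu.1).2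
      simp at this
      tauto
    rw [Set.pair_comm] at hu hv h
    exact this hst.symm hu hv h hx'
  subst hx
  wlog hb : b = false generalizing u v b
  · exact this hv (by simpa using hu) (by simpa using h.symm) (by simpa using hb)
  subst hb
  rw [Bool.not_false] at hv h
  set M := lab A x t
  set φ := state M x (u ++ [(x, false)]) with hφ
  have hL := (len_state_le M x (u ++ [(x, false)])).1
  have h1 := (geo_iff hst hu.1).1 hu
  have h2 := (geo_iff hst hv.1).1 hv
  rw [← state_eq hst h, ← hφ] at h2
  rw [← hφ] at h1
  apply not_len_lt_and_len_lt hL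
  rw [← hφ]
  constructor
  · have : F M (C M φ) = state M x u := by
      rw [hφ, state_append_self_inv]
      simp [F_F]
    rw [← len_F (Lifts.C hL), this]
    have := (len_state_le M x u).2
    simp at h1
    omega
  · have : (C M)⁻¹ (F M φ) = state M x v := by
      rw [hφ, state_eq hst h, state_append_self, F_F]
      exact (C M).symm_apply_apply _
    rw [this]
    have := (len_state_le M x v).2
    simp at h2
    omega

end State

namespace DState

variable {M : ℕ}

/-- The exponent attached to a sign. -/
def sgn (b : Bool) : ℤ := if b then 1 else -1

/-- The permutation `c ^ ±1 * f`. -/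
noncomputable def Z (M : ℕ) (b : Bool) (φ : DState M) : DState M := (C M ^ sgn b) (F M φ)

/-- `f ^ ε`. -/
noncomputable def Fb (M : ℕ) (b : Bool) (φ : DState M) : DState M := if b then F M φ else φ

theorem Fb_Fb (a b : Bool) (φ : DState M) : Fb M a (Fb M b φ) = Fb M (xor a b) φ := by
  cases a <;> cases b <;> simp [Fb, F_F]

theorem Fb_base (a b : Bool) : ∃ b', Fb M a (base M b) = base M b' := by
  cases a
  · exact ⟨b, rfl⟩
  · exact ⟨!b, by simp [Fb, F, flipFun, base]⟩

theorem len_Fb {φ : DState M} (h : ∃ n, IsLift n φ) (b : Bool) : len (Fb M b φ) = len φ := by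
  cases b
  · rfl
  · exact len_F h

theorem isLift_C_zpow {a : ℤ} {l : List ℤ} {φ : DState M} (h : IsLift (a :: l) φ) (b : Bool) :
    IsLift ((a + sgn b) :: l) ((C M ^ sgn b) φ) := by
  cases b
  · simpa [sgn, sub_eq_add_neg] using isLift_C_inv.2 h
  · simpa [sgn] using isLift_C.2 h

/-- `l` lists the exponents of the state `φ`, the current one being nontrivial. -/
def Stack (φ : DState M) (l : List ℤ) : Prop :=
  (l = [] ∧ ∃ b, φ = base M b) ∨ ∃ a l', l = a :: l' ∧ (a : ZMod M) ≠ 0 ∧ IsLift l φ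

theorem cast_ne_zero (hM : M = 0 ∨ 3 ≤ M) {a : ℤ} (ha : a ≠ 0) (ha' : a.natAbs ≤ 2) :
    (a : ZMod M) ≠ 0 := by
  rw [Ne, ZMod.intCast_zmod_eq_zero_iff_dvd]
  intro h
  rcases hM with rfl | hM
  · simp at h; exact ha h
  · have := Nat.le_of_dvd (by omega) (Int.natCast_dvd.1 h)
    omega

theorem Stack.Z (hM : M = 0 ∨ 3 ≤ M) {φ : DState M} {l : List ℤ} (h : Stack φ l) (b : Bool) :
    Stack (Z M b φ) (sgn b :: l) := by
  refine .inr ⟨_, _, rfl, cast_ne_zero hM (by cases b <;> decide) (by cases b <;> decide), ?_⟩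
  rcases h with ⟨rfl, β, rfl⟩ | ⟨a, l', rfl, ha, hl⟩
  · have : F M (base M β) = base M (!β) := by simp [F, flipFun, base]
    rw [DState.Z, this]
    simpa using isLift_C_zpow (isLift_base M (!β)) b
  · have ht : φ.top ≠ 0 := by rwa [← (isLift_cons.1 hl).1]
    rcases exists_isLift_F hl with ⟨-, h⟩ | ⟨h, -⟩ | ⟨h, -⟩
    · have := isLift_C_zpow h b
      rw [zero_add] at this
      exact this
    · exact (ht h).elim
    · exact (ht h).elim

theorem Stack.iterate_Z (hM : M = 0 ∨ 3 ≤ M) {φ : DState M} {l : List ℤ} (h : Stack φ l)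
    (b : Bool) (k : ℕ) : Stack ((DState.Z M b)^[k] φ) (replicate k (sgn b) ++ l) := by
  induction k with
  | zero => simpa
  | succ k ih =>
    rw [Function.iterate_succ_apply', replicate_succ, cons_append]
    exact ih.Z hM b

theorem Stack.Z_F (hM : M = 0 ∨ 3 ≤ M) {φ : DState M} {l : List ℤ} {b : Bool}
    (h : Stack φ (sgn b :: l)) : Stack (DState.Z M b (F M φ)) ((2 * sgn b) :: l) := by
  refine .inr ⟨_, _, rfl, cast_ne_zero hM (by cases b <;> decide) (by cases b <;> decide), ?_⟩
  obtain ⟨h, -⟩ | ⟨a, l', heq, ha, hl⟩ := h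
  · simp at h
  · rw [DState.Z, F_F, two_mul]
    exact isLift_C_zpow hl b

theorem natAbs_le_of_cast_eq (hM : M = 0 ∨ 3 ≤ M) {x y : ℤ} (h : (y : ZMod M) = x) {b : Bool}
    (hx : x = 1 ∨ x = -1 ∨ x = 2 * sgn b) :
    3 * (x.natAbs : ℤ) - sgn b * x ≤ 3 * y.natAbs - sgn b * y := by
  obtain ⟨k, hk⟩ := (ZMod.intCast_eq_intCast_iff_dvd_sub _ _ _).1 h
  have hk' : k = 0 ∨ M = 0 ∨ (3 ≤ M ∧ 1 ≤ k) ∨ (3 ≤ M ∧ k ≤ -1) := by omega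
  have : y = x ∨ y + 3 ≤ x ∨ x + 3 ≤ y := by
    rcases hk' with rfl | h | ⟨h3, h1⟩ | ⟨h3, h1⟩
    · left; simp at hk; omega
    · left; simp [h] at hk; omega
    · right; left; have : (3 : ℤ) ≤ M * k := by nlinarith [(show (3 : ℤ) ≤ M by exact_mod_cast h3)]
      omega
    · right; right
      have : (M : ℤ) * k ≤ -3 := by nlinarith [(show (3 : ℤ) ≤ M by exact_mod_cast h3)]
      omega
  cases b <;> simp only [sgn, Bool.false_eq_true, if_false, if_true] at * <;> omega

theorem cost_le_of_map_eq (hM : M = 0 ∨ 3 ≤ M) {b : Bool} {l : List ℤ}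
    (hl : ∀ x ∈ l, x = 1 ∨ x = -1 ∨ x = 2 * sgn b) (n : List ℤ)
    (h : n.map (Int.cast : ℤ → ZMod M) = l.map Int.cast) :
    3 * (cost l : ℤ) - sgn b * l.sum ≤ 3 * cost n - sgn b * n.sum := by
  induction l generalizing n with
  | nil => obtain rfl : n = [] := by simpa using h
           simp
  | cons x l ih =>
    cases n with
    | nil => simp at h
    | cons y n =>
      simp only [map_cons, List.cons.injEq] at h
      have h1 := ih (fun x hx => hl x (by simp [hx])) n h.2
      have h2 := natAbs_le_of_cast_eq hM h.1 (hl x (by simp))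
      simp only [cost_cons, sum_cons, mul_add] at *
      rw [Nat.cast_add, Nat.cast_add]
      linarith

theorem Stack.lifts {φ : DState M} {l : List ℤ} (h : Stack φ l) : ∃ n, IsLift n φ := by
  obtain ⟨rfl, b, rfl⟩ | ⟨a, l', heq, ha, hl⟩ := h
  · exact ⟨_, isLift_base M b⟩
  · exact ⟨_, hl⟩

theorem Stack.cost_le_len (hM : M = 0 ∨ 3 ≤ M) {φ : DState M} {l : List ℤ} (h : Stack φ l)
    {b : Bool} (hl : ∀ x ∈ l, x = 1 ∨ x = -1 ∨ x = 2 * sgn b) : cost l ≤ len φ := by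
  obtain ⟨n, hn, hc⟩ := exists_cost_eq_len h.lifts
  obtain ⟨rfl, -⟩ | ⟨a, l', heq, ha, hl'⟩ := h
  · simp
  · have := cost_le_of_map_eq hM hl n (hn.1.trans hl'.1.symm)
    rw [hn.2, hl'.2] at this
    omega

end DState

section Zigzag

open DState

theorem state_append_eq_Z (M : ℕ) (s x : S) (b : Bool) (w : Word S) :
    state M s (w ++ [(x, b)]) =
      Fb M (xor (x = s) !b) (Z M b (Fb M (xor (x = s) !b) (state M s w))) := by
  by_cases hx : x = s
  · subst hx
    cases b
    · rw [state_append_self_inv]; simp [Fb, Z, sgn]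
    · rw [state_append_self]; simp [Fb, Z, sgn, F_F]
  · cases b
    · rw [state_append_other_inv _ hx]; simp [Fb, Z, sgn, hx, F_F]
    · rw [state_append_other _ hx]; simp [Fb, Z, sgn, hx]

theorem state_append_replicate (M : ℕ) (s x : S) (b : Bool) (w : Word S) (k : ℕ) :
    state M s (w ++ replicate k (x, b)) =
      Fb M (xor (x = s) !b) ((Z M b)^[k] (Fb M (xor (x = s) !b) (state M s w))) := by
  induction k with
  | zero => simp [Fb_Fb]; rfl
  | succ k ih =>
    rw [replicate_succ', ← append_assoc, state_append_eq_Z, ih, Fb_Fb, Bool.xor_self,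
      Function.iterate_succ_apply']
    rfl

theorem deg_state_of_signed (M : ℕ) (s : S) (b : Bool) (w : Word S) :
    (∀ a ∈ w, a.2 = b) → (state M s w).deg = sgn b * w.length := by
  refine state_induction (p := fun w φ => (∀ a ∈ w, a.2 = b) → φ.deg = sgn b * w.length)
    ?_ ?_ ?_ ?_ ?_ w
  · intro _; simp [base]
  all_goals
    intro w φ
    intros
    rename_i ih h
    have h1 := ih fun a ha => h a (by simp [ha])
    have h2 := h (_, _) (mem_append_right _ (mem_singleton_self _))
    subst h2
    simp only [deg_F, deg_C, deg_C_inv, h1, sgn, length_append, length_singleton, if_true,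
      Bool.false_eq_true, if_false, Nat.cast_add, Nat.cast_one]
    ring

theorem lab_eq_zero_or {A : ArtinData S} {s t : S} (h : 3 ≤ A.m s t) :
    lab A s t = 0 ∨ 3 ≤ lab A s t := by
  by_cases ht : A.m s t = ⊤
  · simp [lab, ht]
  · right
    lift A.m s t to ℕ using ht with k hk
    rw [lab, ← hk]
    simpa using h

/-- Words with at most three syllables, the last of length one, are geodesic. -/
theorem geo_zigzag {A : ArtinData S} {s t : S} (hst : s ≠ t) (h3 : 3 ≤ A.m s t) (j i : ℕ)
    (α β γ : Bool) :
    Geo A {s, t} (replicate j (s, α) ++ replicate (i + 1) (t, β) ++ [(s, γ)]) := by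
  set w := replicate j (s, α) ++ replicate (i + 1) (t, β) ++ [(s, γ)] with hw
  have hwT : WordOver {s, t} w := by
    intro a ha
    simp only [hw, mem_append, mem_replicate, mem_singleton] at ha
    rcases ha with (⟨-, rfl⟩ | ⟨-, rfl⟩) | rfl <;> simp
  have hlen : w.length = j + (i + 1) + 1 := by simp [hw, add_assoc]
  rw [geo_iff hst hwT]
  set M := lab A s t
  have hM : M = 0 ∨ 3 ≤ M := lab_eq_zero_or h3
  refine le_antisymm ?_ (len_state_le M s w).2
  have signed : (∀ a ∈ w, a.2 = β) → w.length ≤ len (state M s w) := by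
    intro h
    have h1 := natAbs_deg_le_len (len_state_le M s w).1
    rw [deg_state_of_signed M s β w h] at h1
    cases β <;> simp only [sgn] at h1 <;> simp at h1 <;> omega
  have hstate : state M s w = Fb M (!!γ) (Z M γ (Fb M (xor (!!γ) !β) ((Z M β)^[i + 1]
      (Fb M (xor (!β) (!!α)) ((Z M α)^[j] (Fb M (!!α) (base M false))))))) := by
    rw [hw, state_append_eq_Z, state_append_replicate, ← nil_append (replicate j (s, α)),
      state_append_replicate, state_nil, Fb_Fb, Fb_Fb]
    simp [hst.symm]
  obtain ⟨b₀, hb₀⟩ := Fb_base (M := M) (!!α) false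
  rw [hb₀] at hstate
  have hcost : ∀ k b, cost (replicate k (sgn b)) = k := by
    intro k b
    induction k with
    | zero => rfl
    | succ k ih => rw [replicate_succ, cost_cons, ih]; cases b <;> simp [sgn] <;> omega
  have hcapp : ∀ l₁ l₂, cost (l₁ ++ l₂) = cost l₁ + cost l₂ := by
    intro l₁ l₂; simp [cost]
  have h1 : Stack ((Z M α)^[j] (base M b₀)) (replicate j (sgn α)) := by
    simpa using Stack.iterate_Z hM (.inl ⟨rfl, b₀, rfl⟩) α j
  have hs1 : ∀ b, (sgn b).natAbs = 1 := by intro b; cases b <;> rfl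
  have hs2 : ∀ b, (2 * sgn b).natAbs = 2 := by intro b; cases b <;> rfl
  have hsgn : ∀ b, sgn b = 1 ∨ sgn b = -1 := by intro b; cases b <;> simp [sgn]
  have hne : ∀ {a b : Bool}, a ≠ b → a = !b := by decide
  have finish : ∀ (φ : DState M) (l : List ℤ), Stack φ l → state M s w = Fb M (!!γ) φ →
      (∃ b, ∀ x ∈ l, x = 1 ∨ x = -1 ∨ x = 2 * sgn b) → cost l = j + (i + 1) + 1 →
      w.length ≤ len (state M s w) := by
    rintro φ l h1 h2 ⟨b, h3⟩ h4
    rw [h2, len_Fb h1.lifts, hlen, ← h4]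
    exact h1.cost_le_len hM h3
  by_cases hβγ : γ = β
  · subst hβγ
    by_cases hj : j = 0
    · refine signed fun a ha => ?_
      simp only [hw, hj, replicate_zero, nil_append, mem_append, mem_replicate,
        mem_singleton] at ha
      rcases ha with ⟨-, rfl⟩ | rfl <;> rfl
    by_cases hα : α = γ
    · refine signed fun a ha => ?_
      subst hα
      simp only [hw, mem_append, mem_replicate, mem_singleton] at ha
      rcases ha with (⟨-, rfl⟩ | ⟨-, rfl⟩) | rfl <;> rfl
    · have e1 : xor (!γ) (!!α) = false := by rw [hne hα]; simp
      have e2 : xor (!!γ) (!γ) = true := by simp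
      rw [e1, e2] at hstate
      have h2 := Stack.iterate_Z hM h1 γ (i + 1)
      rw [replicate_succ, cons_append] at h2
      refine finish _ _ (h2.Z_F hM) hstate ⟨γ, ?_⟩ ?_
      · intro x hx
        simp only [mem_cons, mem_append, mem_replicate] at hx
        rcases hx with rfl | ⟨-, rfl⟩ | ⟨-, rfl⟩
        · simp
        · have := hsgn γ; tauto
        · have := hsgn α; tauto
      · rw [cost_cons, hcapp, hcost, hcost, hs2]; omega
  · have e2 : xor (!!γ) (!β) = false := by rw [hne hβγ]; simp
    rw [e2] at hstate
    by_cases hj : j = 0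
    · subst hj
      obtain ⟨b₁, hb₁⟩ := Fb_base (M := M) (xor (!β) (!!α)) b₀
      simp only [Function.iterate_zero, id_eq, hb₁] at hstate
      have h2 := Stack.iterate_Z hM (.inl ⟨rfl, b₁, rfl⟩) β (i + 1)
      refine finish _ _ (h2.Z hM γ) hstate ⟨γ, ?_⟩ ?_
      · intro x hx
        simp only [mem_cons, mem_append, mem_replicate, not_mem_nil] at hx
        rcases hx with rfl | ⟨-, rfl⟩ | h
        · have := hsgn γ; tauto
        · have := hsgn β; tauto
        · exact h.elim
      · rw [cost_cons, hcapp, hcost, hs1, cost_nil]; omega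
    by_cases hα : α = β
    · subst hα
      have e1 : xor (!α) (!!α) = true := by simp
      rw [e1] at hstate
      obtain ⟨j, rfl⟩ := Nat.exists_eq_succ_of_ne_zero hj
      rw [Nat.succ_eq_add_one, replicate_succ] at h1
      have h2 := Stack.iterate_Z hM (h1.Z_F hM) α i
      rw [← Function.iterate_succ_apply] at h2
      refine finish _ _ (h2.Z hM γ) hstate ⟨α, ?_⟩ ?_
      · intro x hx
        simp only [mem_cons, mem_append, mem_replicate] at hx
        rcases hx with rfl | ⟨-, rfl⟩ | rfl | ⟨-, rfl⟩
        · have := hsgn γ; tauto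
        · have := hsgn α; tauto
        · simp
        · have := hsgn α; tauto
      · rw [cost_cons, hcapp, cost_cons, hcost, hcost, hs1, hs2]; omega
    · have e1 : xor (!β) (!!α) = false := by rw [hne hα]; simp
      rw [e1] at hstate
      have h2 := Stack.iterate_Z hM h1 β (i + 1)
      refine finish _ _ (h2.Z hM γ) hstate ⟨γ, ?_⟩ ?_
      · intro x hx
        simp only [mem_cons, mem_append, mem_replicate] at hx
        rcases hx with rfl | ⟨-, rfl⟩ | ⟨-, rfl⟩
        · have := hsgn γ; tauto
        · have := hsgn β; tauto
        · have := hsgn α; tauto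
      · rw [cost_cons, hcapp, hcost, hcost, hs1]; omega

end Zigzag

/-! ### Geodesics over two generators -/

section Geodesics

variable {A : ArtinData S} {T : Set S}

theorem exists_geo {u : Word S} (hu : WordOver T u) :
    ∃ u', Geo A T u' ∧ wbar (A.on T) u' = wbar (A.on T) u := by
  have h : ∃ n, ∃ u', WordOver T u' ∧ wbar (A.on T) u' = wbar (A.on T) u ∧ u'.length = n :=
    ⟨_, u, hu, rfl, rfl⟩
  obtain ⟨u', h1, h2, h3⟩ := Nat.find_spec h
  exact ⟨u', ⟨h1, fun v hv he => h3 ▸ Nat.find_min' h ⟨v, hv, he.trans h2, rfl⟩⟩, h2⟩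

theorem Geo.of_eq {u u' : Word S} (h : Geo A T u) (hu' : WordOver T u')
    (he : wbar (A.on T) u' = wbar (A.on T) u) (hl : u'.length ≤ u.length) : Geo A T u' :=
  ⟨hu', fun v hv hve => hl.trans (h.2 v hv (hve.trans he))⟩

theorem Geo.length_eq {u u' : Word S} (h : Geo A T u) (h' : Geo A T u')
    (he : wbar (A.on T) u = wbar (A.on T) u') : u.length = u'.length :=
  le_antisymm (h.2 _ h'.1 he.symm) (h'.2 _ h.1 he)

theorem Geo.left {u v : Word S} (h : Geo A T (u ++ v)) : Geo A T u := by
  have hw := wordOver_append.1 h.1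
  refine ⟨hw.1, fun u' hu' he => ?_⟩
  have := h.2 (u' ++ v) (wordOver_append.2 ⟨hu', hw.2⟩) (by rw [wbar_append, he, wbar_append])
  simpa using this

theorem geo_nil : Geo A T [] := ⟨wordOver_nil, fun _ _ _ => Nat.zero_le _⟩

theorem wbar_cancel_right {u v w : Word S} (h : wbar A (u ++ w) = wbar A (v ++ w)) :
    wbar A u = wbar A v := by
  rw [wbar_append, wbar_append] at h
  exact mul_right_cancel h

theorem Geo.append_or {u : Word S} (h : Geo A T u) {x : S} (hx : x ∈ T) (b : Bool) :
    Geo A T (u ++ [(x, b)]) ∨ ∃ u', Geo A T (u' ++ [(x, !b)]) ∧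
      wbar (A.on T) (u' ++ [(x, !b)]) = wbar (A.on T) u := by
  have hw : WordOver T (u ++ [(x, b)]) := wordOver_append.2 ⟨h.1, by simpa⟩
  obtain ⟨u', h1, h2⟩ := exists_geo (A := A) hw
  by_cases hl : u'.length = u.length + 1
  · exact .inl (h1.of_eq hw h2.symm (by simp [hl]))
  · have hp := length_parity h2
    have hle := h1.2 _ hw h2.symm
    rw [length_append, length_singleton] at hp hle
    have e : wbar (A.on T) (u' ++ [(x, !b)]) = wbar (A.on T) u := by
      rw [wbar_append, h2, wbar_append, wbar_singleton_not, mul_inv_cancel_right]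
    refine .inr ⟨u', h.of_eq (wordOver_append.2 ⟨h1.1, by simpa⟩) e ?_, e⟩
    rw [length_append, length_singleton]
    omega

theorem Geo.not_cancel {u : Word S} {x : S} {b : Bool} (h : Geo A T (u ++ [(x, b)]))
    {u' : Word S} (hu' : WordOver T u')
    (he : wbar (A.on T) (u' ++ [(x, !b)]) = wbar (A.on T) u) : u.length + 1 ≤ u'.length := by
  have := h.2 u' hu' (by
    rw [wbar_append, ← he, wbar_append, wbar_singleton_not, inv_mul_cancel_right])
  simpa using this

/-- The set `T` consists of two generators with large label. -/
def IsPair (A : ArtinData S) (T : Set S) : Prop := ∃ s t, s ≠ t ∧ 3 ≤ A.m s t ∧ T = {s, t}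

theorem IsPair.sign_unique (hT : IsPair A T) {u v : Word S} {x : S} {b c : Bool}
    (hu : Geo A T (u ++ [(x, b)])) (hv : Geo A T (v ++ [(x, c)]))
    (h : wbar (A.on T) (u ++ [(x, b)]) = wbar (A.on T) (v ++ [(x, c)])) : b = c := by
  obtain ⟨s, t, hst, -, rfl⟩ := hT
  by_contra hbc
  obtain rfl : c = !b := by cases b <;> cases c <;> simp_all
  exact hu.not_both_signs hst hv h

/-- The word `u` has no geodesic spelling ending with the generator `x`. -/
def NoEnd (A : ArtinData S) (T : Set S) (x : S) (u : Word S) : Prop :=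
  ∀ u' b, Geo A T (u' ++ [(x, b)]) → wbar (A.on T) (u' ++ [(x, b)]) ≠ wbar (A.on T) u

/-- Strip all the letters `(x, b)` at the end of a geodesic. -/
theorem exists_strip (k : Word S) (x : S) (b : Bool)
    (h : Geo A T (k ++ [(x, b)])) :
    ∃ g i, Geo A T (g ++ replicate (i + 1) (x, b)) ∧ NoEnd A T x g ∧
      wbar (A.on T) (g ++ replicate (i + 1) (x, b)) = wbar (A.on T) (k ++ [(x, b)]) := by
  induction hn : k.length generalizing k with
  | zero =>
    obtain rfl : k = [] := List.length_eq_zero_iff.1 hn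
    refine ⟨[], 0, h, fun u' c h1 h2 => ?_, rfl⟩
    have := h1.length_eq geo_nil h2
    simp at this
  | succ n ih =>
    by_cases hk : ∃ k' c, Geo A T (k' ++ [(x, c)]) ∧
        wbar (A.on T) (k' ++ [(x, c)]) = wbar (A.on T) k
    · obtain ⟨k', c, h1, h2⟩ := hk
      have hbc : c = b := by
        by_contra hcb
        obtain rfl : c = !b := by cases b <;> cases c <;> simp_all
        have h3 := h.not_cancel (h1.left).1 h2
        have h4 := h1.length_eq h.left h2
        simp at h4
        omega
      subst hbc
      have hl := h1.length_eq h.left h2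
      obtain ⟨g, i, h3, h4, h5⟩ := ih k' h1 (by simp at hl; omega)
      have e : wbar (A.on T) (g ++ replicate (i + 1 + 1) (x, c)) =
          wbar (A.on T) (k ++ [(x, c)]) := by
        rw [replicate_succ', ← append_assoc, wbar_append, h5, h2, ← wbar_append]
      refine ⟨g, i + 1, h.of_eq ?_ e ?_, h4, e⟩
      · rw [replicate_succ', ← append_assoc, wordOver_append]
        exact ⟨h3.1, (wordOver_append.1 h.1).2⟩
      · have := h3.length_eq h1 h5
        simp at this hl ⊢
        omega
    · exact ⟨k, 0, by simpa using h, fun u' c h1 h2 => hk ⟨u', c, h1, h2⟩, rfl⟩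

/-- A geodesic ending with `s` and with `t` has syllable length at least three after any
spelling. -/
theorem exists_three_syllables {s t : S} (hst : s ≠ t) (h3 : 3 ≤ A.m s t) {k k' : Word S}
    {α β : Bool} (hk : Geo A {s, t} (k ++ [(s, α)])) (hk' : Geo A {s, t} (k' ++ [(t, β)]))
    (he : wbar (A.on {s, t}) (k ++ [(s, α)]) = wbar (A.on {s, t}) (k' ++ [(t, β)])) :
    ∃ g α' β' i j, Geo A {s, t} (g ++ [(t, β')] ++ replicate (j + 1) (s, α') ++
        replicate (i + 1) (t, β)) ∧
      wbar (A.on {s, t}) (g ++ [(t, β')] ++ replicate (j + 1) (s, α') ++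
        replicate (i + 1) (t, β)) = wbar (A.on {s, t}) (k' ++ [(t, β)]) ∧
      NoEnd A {s, t} t (g ++ [(t, β')] ++ replicate (j + 1) (s, α')) ∧
      NoEnd A {s, t} s (g ++ [(t, β')]) := by
  have key : ∀ j i γ, wbar (A.on {s, t}) (replicate j (s, γ) ++ replicate (i + 1) (t, β)) ≠
      wbar (A.on {s, t}) (k ++ [(s, α)]) := by
    intro j i γ h
    have h1 := geo_zigzag hst h3 j i γ β (!α)
    have h2 := h1.not_cancel (u' := k) hk.left.1 (by rw [h, Bool.not_not])
    have h3 := h1.left.length_eq hk h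
    rw [length_append, length_append] at h3
    simp at h2 h3
    omega
  obtain ⟨g₀, i, h1, h2, h4⟩ := exists_strip k' t β hk'
  rcases List.eq_nil_or_concat g₀ with rfl | ⟨g₁, ⟨x, α'⟩, rfl⟩
  · exact (key 0 i α (by simpa using h4.trans he.symm)).elim
  rw [concat_eq_append] at *
  have hx : x = s := by
    have := h1.1 (x, α') (by simp)
    refine this.resolve_right fun hxt => ?_
    simp only at hxt
    subst hxt
    exact h2 g₁ α' h1.left rfl
  subst hx
  obtain ⟨g₂, j, h5, h6, h7⟩ := exists_strip g₁ x α' h1.left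
  rcases List.eq_nil_or_concat g₂ with rfl | ⟨g, ⟨y, β'⟩, rfl⟩
  · refine (key (j + 1) i α' ?_).elim
    rw [wbar_append]
    rw [nil_append] at h7
    rw [h7, ← wbar_append, h4, he]
  rw [concat_eq_append] at *
  have hy : y = t := by
    have := h5.1 (y, β') (by simp)
    refine this.resolve_left fun hxt => ?_
    simp only at hxt
    subst hxt
    exact h6 g β' h5.left rfl
  subst hy
  have e : wbar (A.on {x, y}) (g ++ [(y, β')] ++ replicate (j + 1) (x, α') ++
        replicate (i + 1) (y, β)) = wbar (A.on {x, y}) (k' ++ [(y, β)]) := by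
    rw [wbar_append, h7, ← wbar_append, h4]
  refine ⟨g, α', β', i, j, hk'.of_eq ?_ e ?_, e, ?_, h6⟩
  · exact wordOver_append.2 ⟨h5.1, (wordOver_append.1 h1.1).2⟩
  · have l1 := h5.length_eq h1.left h7
    have l2 := h1.length_eq hk' h4
    simp at l1 l2 ⊢
    omega
  · intro u' b hu' hb
    exact h2 u' b hu' (hb.trans h7)

/-- A geodesic over one generator is a power of a letter. -/
theorem Geo.eq_replicate {x : S} {u : Word S} (h : Geo A T u) (hx : ∀ a ∈ u, a.1 = x) :
    ∃ k b, u = replicate k (x, b) := by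
  induction u using List.reverseRecOn with
  | nil => exact ⟨0, true, rfl⟩
  | append_singleton u a ih =>
    obtain ⟨k, b, rfl⟩ := ih h.left fun a ha => hx a (by simp [ha])
    obtain ⟨y, c⟩ := a
    obtain rfl : y = x := hx (y, c) (by simp)
    cases k with
    | zero => exact ⟨1, c, rfl⟩
    | succ k =>
      by_cases hbc : b = c
      · subst hbc
        exact ⟨k + 1 + 1, b, by rw [← replicate_succ']⟩
      · obtain rfl : b = !c := by cases b <;> cases c <;> simp_all
        have h1 := h.not_cancel (u' := replicate k (y, !c)) (fun a ha => h.1 a (by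
          have := eq_of_mem_replicate ha
          simp [this])) (by rw [← replicate_succ'])
        simp at h1

/-- Equal geodesics over a pair use the same generators. -/
theorem IsPair.wordOver_of_eq (hT : IsPair A T) {u u' : Word S} (hu : Geo A T u)
    (hu' : Geo A T u') (he : wbar (A.on T) u = wbar (A.on T) u') {S₀ : Set S}
    (h : WordOver S₀ u) : WordOver S₀ u' := by
  obtain ⟨s, t, hst, h3, rfl⟩ := hT
  by_cases hs : s ∈ S₀
  · by_cases ht : t ∈ S₀
    · intro a ha
      rcases hu'.1 a ha with h | h
      · rwa [h]
      · rw [h]; exact ht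
    · have hus : ∀ a ∈ u, a.1 = s := fun a ha =>
        (hu.1 a ha).resolve_right fun h' => ht (h' ▸ h a ha)
      rw [Set.pair_comm] at hu hu' he
      have := one_letter hst.symm (by rwa [A.symm]) hu hu' he hus
      exact fun a ha => by rw [this a ha]; exact hs
  · have hus : ∀ a ∈ u, a.1 = t := fun a ha =>
        (hu.1 a ha).resolve_left fun h' => hs (h' ▸ h a ha)
    have := one_letter hst h3 hu hu' he hus
    intro a ha
    have hat := this a ha
    rcases List.eq_nil_or_concat u with rfl | ⟨u₁, b, rfl⟩
    · have := hu.length_eq hu' he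
      rw [List.length_eq_zero_iff.1 this.symm] at ha
      simp at ha
    · rw [hat, ← hus b (by simp)]
      exact h b (by simp)
where
  one_letter {s t : S} (hst : s ≠ t) (h3 : 3 ≤ A.m s t) {u u' : Word S} (hu : Geo A {s, t} u)
      (hu' : Geo A {s, t} u') (he : wbar (A.on {s, t}) u = wbar (A.on {s, t}) u')
      (h : ∀ a ∈ u, a.1 = t) : ∀ a ∈ u', a.1 = t := by
    induction u' using List.reverseRecOn generalizing u with
    | nil => simp
    | append_singleton u' c ih =>
      obtain ⟨x, γ⟩ := c
      obtain ⟨k, β, rfl⟩ := hu.eq_replicate h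
      have hl := hu.length_eq hu' he
      rw [length_append, length_singleton, length_replicate] at hl
      obtain rfl := hl
      rcases hu'.1 (x, γ) (by simp) with hx | hx
      · simp only at hx
        subst hx
        have h1 := geo_zigzag hst h3 0 u'.length true β (!γ)
        have h2 := h1.not_cancel (u' := u') hu'.left.1 (by
          rw [Bool.not_not, replicate_zero, nil_append, he])
        simp at h2
      · simp only [Set.mem_singleton_iff] at hx
        subst hx
        rw [replicate_succ'] at hu he
        obtain rfl := IsPair.sign_unique ⟨s, x, hst, h3, rfl⟩ hu hu' he
        have := ih hu.left hu'.left (wbar_cancel_right he) fun a ha => by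
          rw [eq_of_mem_replicate ha]
        intro a ha
        rcases mem_append.1 ha with ha | ha
        · exact this a ha
        · rw [mem_singleton.1 ha]

end Geodesics

/-! ### Dihedral moves and reduced words -/

section Moves

variable {A : ArtinData S} {T : Set S}

theorem IsPair.eq_pair (hT : IsPair A T) {x y : S} (hx : x ∈ T) (hy : y ∈ T) (hxy : x ≠ y) :
    T = {x, y} := by
  obtain ⟨s, t, -, -, rfl⟩ := hT
  rcases hx with rfl | rfl <;> rcases hy with rfl | rfl
  · exact (hxy rfl).elim
  · rfl
  · exact Set.pair_comm _ _
  · exact (hxy rfl).elim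

/-- Replace a dihedral geodesic factor by an equal one. -/
def Move (A : ArtinData S) (w w' : Word S) : Prop :=
  ∃ T p q u u', IsPair A T ∧ Geo A T u ∧ Geo A T u' ∧ wbar (A.on T) u = wbar (A.on T) u' ∧
    w = p ++ u ++ q ∧ w' = p ++ u' ++ q

/-- The congruence generated by the dihedral moves. -/
def Sim (A : ArtinData S) : Word S → Word S → Prop := Relation.ReflTransGen (Move A)

theorem Move.symm {w w' : Word S} (h : Move A w w') : Move A w' w := by
  obtain ⟨T, p, q, u, u', hT, hu, hu', he, rfl, rfl⟩ := h
  exact ⟨T, p, q, u', u, hT, hu', hu, he.symm, rfl, rfl⟩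

theorem Sim.refl (w : Word S) : Sim A w w := Relation.ReflTransGen.refl

theorem Sim.trans {u v w : Word S} (h : Sim A u v) (h' : Sim A v w) : Sim A u w :=
  Relation.ReflTransGen.trans h h'

theorem Sim.symm {u v : Word S} (h : Sim A u v) : Sim A v u := by
  induction h with
  | refl => exact Sim.refl _
  | tail _ h ih => exact Relation.ReflTransGen.head h.symm ih

theorem Sim.append {u v : Word S} (h : Sim A u v) (p q : Word S) :
    Sim A (p ++ u ++ q) (p ++ v ++ q) := by
  induction h with
  | refl => exact Sim.refl _
  | tail _ h ih =>
    obtain ⟨T, p', q', u, u', hT, hu, hu', he, rfl, rfl⟩ := h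
    exact ih.tail ⟨T, p ++ p', q' ++ q, u, u', hT, hu, hu', he, by simp, by simp⟩

theorem Sim.append_right {u v : Word S} (h : Sim A u v) (q : Word S) :
    Sim A (u ++ q) (v ++ q) := h.append [] q

theorem Sim.append_left {u v : Word S} (h : Sim A u v) (p : Word S) :
    Sim A (p ++ u) (p ++ v) := by simpa using h.append p []

theorem IsPair.sim (hT : IsPair A T) {u u' : Word S} (hu : Geo A T u) (hu' : Geo A T u')
    (he : wbar (A.on T) u = wbar (A.on T) u') : Sim A u u' :=
  Relation.ReflTransGen.single ⟨T, [], [], u, u', hT, hu, hu', he, by simp, by simp⟩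

theorem Sim.length_eq {u v : Word S} (h : Sim A u v) : u.length = v.length := by
  induction h with
  | refl => rfl
  | tail _ h ih =>
    obtain ⟨T, p', q', u, u', hT, hu, hu', he, rfl, rfl⟩ := h
    rw [ih]
    simp [hu.length_eq hu' he]

theorem Sim.wbar_eq {u v : Word S} (h : Sim A u v) : wbar A u = wbar A v := by
  induction h with
  | refl => rfl
  | tail _ h ih =>
    obtain ⟨T, p', q', u, u', hT, hu, hu', he, rfl, rfl⟩ := h
    rw [ih]
    simp only [wbar_append, wbar_eq_of_on he]

theorem Sim.wordOver {u v : Word S} (h : Sim A u v) {S₀ : Set S} (hu : WordOver S₀ u) :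
    WordOver S₀ v := by
  induction h with
  | refl => exact hu
  | tail _ h ih =>
    obtain ⟨T, p', q', u, u', hT, hu, hu', he, rfl, rfl⟩ := h
    rw [wordOver_append, wordOver_append] at ih ⊢
    exact ⟨⟨ih.1.1, hT.wordOver_of_eq hu hu' he ih.1.2⟩, ih.2⟩

/-- Words in which no cancellation occurs up to dihedral moves. -/
inductive Red (A : ArtinData S) : Word S → Prop
  | nil : Red A []
  | snoc {w : Word S} {x : S} {b : Bool} (hw : Red A w)
      (h : ∀ w', ¬ Sim A w (w' ++ [(x, !b)])) : Red A (w ++ [(x, b)])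

theorem red_snoc_iff {w : Word S} {x : S} {b : Bool} :
    Red A (w ++ [(x, b)]) ↔ Red A w ∧ ∀ w', ¬ Sim A w (w' ++ [(x, !b)]) := by
  refine ⟨fun h => ?_, fun h => .snoc h.1 h.2⟩
  generalize hv : w ++ [(x, b)] = v at h
  cases h with
  | nil => simp at hv
  | snoc hw h =>
    obtain ⟨rfl, h2⟩ := append_inj' hv rfl
    simp only [cons.injEq, Prod.mk.injEq, and_true] at h2
    obtain ⟨rfl, rfl⟩ := h2
    exact ⟨hw, h⟩

theorem Red.left {w v : Word S} (h : Red A (w ++ v)) : Red A w := by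
  induction v using List.reverseRecOn with
  | nil => simpa using h
  | append_singleton v a ih =>
    rw [← append_assoc] at h
    exact ih (red_snoc_iff.1 h).1

theorem Red.congr_left {w w' q : Word S} (h : Red A (w ++ q)) (hw : Red A w')
    (hs : Sim A w w') : Red A (w' ++ q) := by
  induction q using List.reverseRecOn with
  | nil => simpa using hw
  | append_singleton v a ih =>
    obtain ⟨x, b⟩ := a
    rw [← append_assoc] at h ⊢
    obtain ⟨h1, h2⟩ := red_snoc_iff.1 h
    exact .snoc (ih h1) fun w₁ h₁ => h2 w₁ ((hs.append_right v).trans h₁)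

theorem Red.geo (hT : IsPair A T) {v u : Word S} (h : Red A (v ++ u)) (hu : WordOver T u) :
    Geo A T u := by
  induction u using List.reverseRecOn with
  | nil => exact geo_nil
  | append_singleton u a ih =>
    obtain ⟨x, b⟩ := a
    rw [← append_assoc] at h
    obtain ⟨h1, h2⟩ := red_snoc_iff.1 h
    obtain ⟨h3, h4⟩ := wordOver_append.1 hu
    refine ((ih h1 h3).append_or (wordOver_singleton.1 h4) b).resolve_right ?_
    rintro ⟨u', h5, h6⟩
    refine h2 (v ++ u') ?_
    rw [append_assoc]
    exact (hT.sim (ih h1 h3) h5 h6.symm).append_left v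

/-- The generator `q` is a right descent of `w`. -/
def Desc (A : ArtinData S) (q : S) (w : Word S) : Prop := ∃ w' b, Sim A w (w' ++ [(q, b)])

/-- No generator in `T` is a right descent of `w`. -/
def NoDesc (A : ArtinData S) (T : Set S) (w : Word S) : Prop := ∀ q ∈ T, ¬ Desc A q w

theorem Desc.congr {q : S} {w w' : Word S} (h : Desc A q w) (hs : Sim A w w') : Desc A q w' := by
  obtain ⟨v, b, hv⟩ := h
  exact ⟨v, b, hs.symm.trans hv⟩

theorem desc_append {q : S} {w u : Word S} {b : Bool} : Desc A q (w ++ (u ++ [(q, b)])) :=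
  ⟨w ++ u, b, by rw [append_assoc]; exact Sim.refl _⟩

theorem desc_of_wordOver {v u : Word S} (hu : WordOver T u) (h : u ≠ []) :
    ∃ q ∈ T, Desc A q (v ++ u) := by
  rcases List.eq_nil_or_concat u with rfl | ⟨u₁, ⟨q, b⟩, rfl⟩
  · exact (h rfl).elim
  · rw [concat_eq_append] at *
    exact ⟨q, hu (q, b) (by simp), desc_append⟩

theorem exists_gate (A : ArtinData S) (T : Set S) (w : Word S) :
    ∃ v u, Sim A w (v ++ u) ∧ WordOver T u ∧ NoDesc A T v := by
  induction hn : w.length generalizing w with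
  | zero =>
    obtain rfl : w = [] := List.length_eq_zero_iff.1 hn
    refine ⟨[], [], Sim.refl _, wordOver_nil, fun q _ ⟨w', b, h⟩ => ?_⟩
    simpa using h.length_eq
  | succ n ih =>
    by_cases h : NoDesc A T w
    · exact ⟨w, [], by simpa using Sim.refl w, wordOver_nil, h⟩
    · simp only [NoDesc, not_forall, not_not] at h
      obtain ⟨q, hq, w', b, hs⟩ := h
      obtain ⟨v, u, h1, h2, h3⟩ := ih w' (by have := hs.length_eq; simp at this; omega)
      refine ⟨v, u ++ [(q, b)], ?_, wordOver_append.2 ⟨h2, by simpa⟩, h3⟩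
      rw [← append_assoc]
      exact hs.trans (h1.append_right _)

end Moves

/-! ### Exchange for reduced words of bounded length -/

section Exchange

variable {A : ArtinData S} {T : Set S}

/-- Two one-letter decompositions that differ by a dihedral geodesic ending. -/
def Joined (A : ArtinData S) (x : Word S) (a : S × Bool) (y : Word S) (b : S × Bool) : Prop :=
  a.1 ≠ b.1 ∧ ∃ v k k', Red A v ∧ NoDesc A {a.1, b.1} v ∧ Sim A x (v ++ k) ∧
    Sim A y (v ++ k') ∧ Geo A {a.1, b.1} (k ++ [a]) ∧ Geo A {a.1, b.1} (k' ++ [b]) ∧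
    wbar (A.on {a.1, b.1}) (k ++ [a]) = wbar (A.on {a.1, b.1}) (k' ++ [b])

/-- The two possible relations between last letters of equivalent reduced words. -/
def LastRel (A : ArtinData S) (x : Word S) (a : S × Bool) (y : Word S) (b : S × Bool) : Prop :=
  (a = b ∧ Sim A x y) ∨ Joined A x a y b

/-- The exchange properties for reduced words of length at most `n`. -/
structure Exchange (A : ArtinData S) (n : ℕ) : Prop where
  red : ∀ {w w' : Word S}, w.length ≤ n → Red A w → Sim A w w' → Red A w'
  last : ∀ {x a y b}, x.length + 1 ≤ n → Red A (x ++ [a]) → Sim A (x ++ [a]) (y ++ [b]) →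
    LastRel A x a y b

theorem Joined.symm {x y : Word S} {a b : S × Bool} (h : Joined A x a y b) :
    Joined A y b x a := by
  obtain ⟨hab, v, k, k', h1, h2, h3, h4, h5, h6, h7⟩ := h
  rw [Set.pair_comm] at h2 h5 h6 h7
  exact ⟨hab.symm, v, k', k, h1, h2, h4, h3, h6, h5, h7.symm⟩

theorem Joined.congr_right {x y z : Word S} {a b : S × Bool} (h : Joined A x a y b)
    (hs : Sim A y z) : Joined A x a z b := by
  obtain ⟨hab, v, k, k', h1, h2, h3, h4, h5⟩ := h
  exact ⟨hab, v, k, k', h1, h2, h3, hs.symm.trans h4, h5⟩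

variable {n : ℕ}

theorem Exchange.gate_unique (hn : Exchange A n) (hT : IsPair A T) {v u v' u' : Word S}
    (hl : (v ++ u).length ≤ n) (hr : Red A (v ++ u)) (hs : Sim A (v ++ u) (v' ++ u'))
    (hv : NoDesc A T v) (hv' : NoDesc A T v') (hu : WordOver T u) (hu' : WordOver T u') :
    Sim A v v' ∧ wbar (A.on T) u = wbar (A.on T) u' := by
  induction hm : u.length generalizing v u v' u' with
  | zero =>
    obtain rfl : u = [] := List.length_eq_zero_iff.1 hm
    by_cases h : u' = []
    · subst h
      exact ⟨by simpa using hs, rfl⟩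
    · obtain ⟨q, hq, hd⟩ := desc_of_wordOver (A := A) (v := v') hu' h
      rw [append_nil] at hs
      exact (hv q hq (hd.congr hs.symm)).elim
  | succ m ih =>
    rcases List.eq_nil_or_concat u with rfl | ⟨u₀, a, rfl⟩
    · simp at hm
    rcases List.eq_nil_or_concat u' with rfl | ⟨u₀', b, rfl⟩
    · obtain ⟨q, hq, hd⟩ := desc_of_wordOver (A := A) (v := v) hu (by simp)
      rw [append_nil] at hs
      exact (hv' q hq (hd.congr hs)).elim
    simp only [concat_eq_append] at *
    obtain ⟨hu0, ha⟩ := wordOver_append.1 hu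
    obtain ⟨hu0', hb⟩ := wordOver_append.1 hu'
    rw [← append_assoc] at hl hr hs
    rw [← append_assoc] at hs
    have hl0 : (v ++ u₀).length ≤ n := by simp at hl ⊢; omega
    have hm0 : u₀.length = m := by simpa using hm
    rcases hn.last (by simpa [Nat.add_assoc] using hl) hr hs with ⟨rfl, h⟩ | h
    · obtain ⟨h1, h2⟩ := ih hl0 hr.left h hv hv' hu0 hu0' hm0
      exact ⟨h1, by rw [wbar_append, h2, wbar_append]⟩
    · obtain ⟨hab, v₁, k, k', -, h2, h3, h4, h5, h6, h7⟩ := h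
      rw [← hT.eq_pair (wordOver_singleton.1 ha) (wordOver_singleton.1 hb) hab] at h2 h5 h6 h7
      obtain ⟨e1, e2⟩ := ih hl0 hr.left h3 hv h2 hu0 h5.left.1 hm0
      have hlk := h5.length_eq h6 h7
      have l1 := h3.length_eq
      have l2 := e1.length_eq
      have l3 := h4.length_eq
      have l4 := hs.length_eq
      simp only [length_append, length_singleton] at hlk l1 l2 l3 l4 hl0
      have hr' : Red A (v₁ ++ k') :=
        hn.red (by simp; omega) (hn.red hl hr hs).left h4
      obtain ⟨e3, e4⟩ := ih (by simp; omega) hr' h4.symm h2 hv' h6.left.1 hu0' (by omega)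
      refine ⟨e1.trans e3, ?_⟩
      rw [wbar_append, e2, ← wbar_append, h7, wbar_append, e4, wbar_append]

theorem Exchange.gate_unique_single (hn : Exchange A n) {q : S} {v u v' u' : Word S}
    (hl : (v ++ u).length ≤ n) (hr : Red A (v ++ u)) (hs : Sim A (v ++ u) (v' ++ u'))
    (hv : NoDesc A {q} v) (hv' : NoDesc A {q} v') (hu : WordOver {q} u)
    (hu' : WordOver {q} u') : Sim A v v' := by
  induction u using List.reverseRecOn generalizing u' with
  | nil =>
    by_cases h : u' = []
    · subst h
      simpa using hs
    · obtain ⟨q, hq, hd⟩ := desc_of_wordOver (A := A) (v := v') hu' h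
      rw [append_nil] at hs
      exact (hv q hq (hd.congr hs.symm)).elim
  | append_singleton u₀ a ih =>
    rcases List.eq_nil_or_concat u' with rfl | ⟨u₀', b, rfl⟩
    · obtain ⟨q, hq, hd⟩ := desc_of_wordOver (A := A) (v := v) hu (by simp)
      rw [append_nil] at hs
      exact (hv' q hq (hd.congr hs)).elim
    simp only [concat_eq_append] at *
    obtain ⟨hu0, ha⟩ := wordOver_append.1 hu
    obtain ⟨hu0', hb⟩ := wordOver_append.1 hu'
    rw [← append_assoc] at hl hr hs
    rw [← append_assoc] at hs
    rcases hn.last (by simpa [Nat.add_assoc] using hl) hr hs with ⟨rfl, h⟩ | h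
    · exact ih (by simp at hl ⊢; omega) hr.left h hu0 hu0'
    · simp only [wordOver_singleton, Set.mem_singleton_iff] at ha hb
      exact (h.1 (ha.trans hb.symm)).elim

theorem Exchange.gate_desc (hn : Exchange A n) (hT : IsPair A T) {v u : Word S}
    (hl : (v ++ u).length ≤ n) (hr : Red A (v ++ u)) (hv : NoDesc A T v) (hu : Geo A T u)
    {w : Word S} {x : S} {b : Bool} (hx : x ∈ T) (hs : Sim A (v ++ u) (w ++ [(x, b)])) :
    ∃ u', Geo A T (u' ++ [(x, b)]) ∧ wbar (A.on T) (u' ++ [(x, b)]) = wbar (A.on T) u := by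
  obtain ⟨v₁, u₁, h1, h2, h3⟩ := exists_gate A T w
  have hs' : Sim A (v ++ u) (v₁ ++ (u₁ ++ [(x, b)])) := by
    rw [← append_assoc]
    exact hs.trans (h1.append_right _)
  have hw : WordOver T (u₁ ++ [(x, b)]) := wordOver_append.2 ⟨h2, by simpa⟩
  obtain ⟨e1, e2⟩ := hn.gate_unique hT hl hr hs' hv h3 hu.1 hw
  refine ⟨u₁, hu.of_eq hw e2.symm ?_, e2.symm⟩
  have l1 := hs'.length_eq
  have l2 := e1.length_eq
  simp only [length_append] at l1 l2 ⊢
  omega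

theorem Exchange.red_append (hn : Exchange A n) (hT : IsPair A T) {v u : Word S}
    (hl : (v ++ u).length ≤ n + 1) (hr : Red A v) (hv : NoDesc A T v) (hu : Geo A T u) :
    Red A (v ++ u) := by
  induction u using List.reverseRecOn with
  | nil => simpa using hr
  | append_singleton u a ih =>
    obtain ⟨x, b⟩ := a
    have hl' : (v ++ u).length ≤ n := by simp at hl ⊢; omega
    have h1 := ih (by omega) hu.left
    rw [← append_assoc]
    refine h1.snoc fun w hw => ?_
    obtain ⟨u', h2, h3⟩ := hn.gate_desc hT hl' h1 hv hu.left (hu.1 (x, b) (by simp)) hw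
    have h4 := hu.not_cancel h2.left.1 h3
    have h5 := h2.length_eq hu.left h3
    simp at h5
    omega

/-- The word `w₀` is obtained from `w` by removing all final powers of `q`. -/
def Strip (A : ArtinData S) (q : S) (w w₀ : Word S) : Prop :=
  NoDesc A {q} w₀ ∧ ∃ u, WordOver {q} u ∧ Sim A w (w₀ ++ u)

theorem Strip.congr_left {q : S} {w w' w₀ : Word S} (h : Strip A q w w₀) (hs : Sim A w' w) :
    Strip A q w' w₀ := by
  obtain ⟨h, u, hu, hw⟩ := h
  exact ⟨h, u, hu, hs.trans hw⟩

theorem Strip.congr_right {q : S} {w w₀ w₁ : Word S} (h : Strip A q w w₀) (hs : Sim A w₀ w₁) :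
    Strip A q w w₁ := by
  obtain ⟨h, u, hu, hw⟩ := h
  exact ⟨fun q hq hd => h q hq (hd.congr hs.symm), u, hu, hw.trans (hs.append_right u)⟩

theorem Strip.append {q : S} {b : Bool} {w w₀ : Word S} (h : Strip A q w w₀) :
    Strip A q (w ++ [(q, b)]) w₀ := by
  obtain ⟨h, u, hu, hw⟩ := h
  refine ⟨h, u ++ [(q, b)], wordOver_append.2 ⟨hu, by simp⟩, ?_⟩
  rw [← append_assoc]
  exact hw.append_right _

theorem Exchange.strip_unique (hn : Exchange A n) {q : S} {w w₁ w₂ : Word S}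
    (hl : w.length ≤ n) (hr : Red A w) (h₁ : Strip A q w w₁) (h₂ : Strip A q w w₂) :
    Sim A w₁ w₂ := by
  obtain ⟨h1, u, hu, hw⟩ := h₁
  obtain ⟨h2, u', hu', hw'⟩ := h₂
  exact hn.gate_unique_single (hw.length_eq ▸ hl) (hn.red hl hr hw) (hw.symm.trans hw') h1 h2
    hu hu'

theorem Joined.unwind (hn : Exchange A n) (hA : ∀ s t : S, s ≠ t → 3 ≤ A.m s t)
    {x y : Word S} {a b : S × Bool} (hl : y.length ≤ n) (h : Joined A x a y b) :
    ∃ y₀ y₁, Red A y₀ ∧ Strip A b.1 y y₀ ∧ Desc A a.1 y₀ ∧ Strip A a.1 y₀ y₁ ∧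
      Desc A b.1 y₁ := by
  obtain ⟨hab, v, k, k', h1, h2, h3, h4, h5, h6, h7⟩ := h
  obtain ⟨s, α⟩ := a
  obtain ⟨t, β⟩ := b
  simp only at *
  have hT : IsPair A {s, t} := ⟨s, t, hab, hA s t hab, rfl⟩
  obtain ⟨g, α', β', i, j, e1, e2, e3, e4⟩ := exists_three_syllables hab (hA s t hab) h5 h6 h7
  have hlk := e1.length_eq h6 e2
  rw [replicate_succ' (n := i), ← append_assoc] at e1 e2 hlk
  have e5 := wbar_cancel_right e2
  have hs := h4.trans ((hT.sim h6.left e1.left e5.symm).append_left v)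
  have hly := hs.length_eq
  rw [← append_assoc] at hs
  have hr0 : Red A (v ++ (g ++ [(t, β')] ++ replicate (j + 1) (s, α'))) :=
    hn.red_append hT (by simp at hly ⊢; omega) h1 h2 e1.left.left
  have hr1 : Red A (v ++ (g ++ [(t, β')])) := by
    rw [← append_assoc] at hr0
    exact hr0.left
  refine ⟨_, v ++ (g ++ [(t, β')]), hr0, ⟨?_, _, ?_, hs⟩, ?_, ⟨?_, replicate (j + 1) (s, α'), ?_, ?_⟩,
    desc_append⟩
  · rintro q rfl ⟨w', c, hw'⟩
    obtain ⟨u', hu', hu''⟩ := hn.gate_desc hT (by simp at hly ⊢; omega) hr0 h2 e1.left.left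
      (by simp) hw'
    exact e3 u' c hu' hu''
  · exact fun c hc => by rw [eq_of_mem_replicate hc]; rfl
  · rw [replicate_succ', ← append_assoc (g ++ _)]
    exact desc_append
  · rintro q rfl ⟨w', c, hw'⟩
    obtain ⟨u', hu', hu''⟩ := hn.gate_desc hT (by simp at hly ⊢; omega) hr1 h2
      e1.left.left.left (by simp) hw'
    exact e4 u' c hu' hu''
  · exact fun c hc => by rw [eq_of_mem_replicate hc]; rfl
  · rw [append_assoc v]
    exact Sim.refl _

theorem Exchange.no_three (hn : Exchange A n) (hA : ∀ s t : S, s ≠ t → 3 ≤ A.m s t)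
    {q r p : S} (hqr : q ≠ r) (hqp : q ≠ p) (hrp : r ≠ p) {w w₀ : Word S} (hl : w.length ≤ n)
    (hr : Red A w) (hdq : Desc A q w) (hdr : Desc A r w) (hst : Strip A q w w₀)
    (hdp : Desc A p w₀) : False := by
  induction hm : w.length using Nat.strong_induction_on generalizing w w₀ q r p with
  | _ m ih =>
  obtain ⟨x, α, hx⟩ := hdq
  obtain ⟨y, β, hy⟩ := hdr
  have lx := hx.length_eq
  have ly := hy.length_eq
  simp only [length_append, length_singleton] at lx ly
  have hj : Joined A y (r, β) x (q, α) :=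
    (hn.last (by omega) (hn.red hl hr hy) (hy.symm.trans hx)).resolve_left fun h =>
      hqr (congrArg Prod.fst h.1).symm
  obtain ⟨x₀, x₁, h0, h1, h2, h3, h4⟩ := hj.unwind hn hA (by omega)
  have hlx : x₀.length ≤ x.length := by
    obtain ⟨-, u, -, hu⟩ := h1
    have := hu.length_eq
    simp at this
    omega
  have hss := hn.strip_unique hl hr hst (h1.append.congr_left hx)
  exact ih x₀.length (by omega) hrp hqr.symm hqp.symm (by omega) h0 h2 (hdp.congr hss) h3 h4 rfl

end Exchange

section ExchangeHolds

variable {A : ArtinData S} {T : Set S} {n : ℕ}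

theorem exchange_zero : Exchange A 0 where
  red {w w'} hl hr hs := by
    obtain rfl : w = [] := List.length_eq_zero_iff.1 (Nat.le_zero.1 hl)
    obtain rfl : w' = [] := List.length_eq_zero_iff.1 hs.length_eq.symm
    exact hr
  last hl := by omega

theorem Exchange.red_move (hn : Exchange A n) {w w' : Word S} (hl : w.length ≤ n + 1)
    (hr : Red A w) (hs : Move A w w') : Red A w' := by
  obtain ⟨T, p, q, u, u', hT, hu, hu', he, rfl, rfl⟩ := hs
  have hss := (hT.sim hu hu' he).append_left p
  by_cases hq : q = []
  · subst hq
    rw [append_nil] at *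
    by_cases hu0 : u = []
    · subst hu0
      obtain rfl : u' = [] := List.length_eq_zero_iff.1 (hu.length_eq hu' he).symm
      exact hr
    · have hp : p.length ≤ n := by
        have := List.length_pos_of_ne_nil hu0
        rw [length_append] at hl
        omega
      obtain ⟨v, g, h1, h2, h3⟩ := exists_gate A T p
      have hvg := hn.red hp hr.left h1
      have h4 := hr.congr_left hvg h1
      rw [append_assoc] at h4
      have h5 := h4.geo hT (wordOver_append.2 ⟨h2, hu.1⟩)
      have e : wbar (A.on T) (g ++ u') = wbar (A.on T) (g ++ u) := by
        rw [wbar_append, wbar_append, he]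
      have hlu := hu.length_eq hu' he
      have h6 := h5.of_eq (wordOver_append.2 ⟨h2, hu'.1⟩) e (by simp [hlu])
      have h7 := hn.red_append hT (by
        have := h1.length_eq
        simp at this hl ⊢
        omega) hvg.left h3 h6
      rw [← append_assoc] at h7
      exact h7.congr_left hr.left h1.symm
  · have := List.length_pos_of_ne_nil hq
    exact hr.congr_left (hn.red (by simp at hl ⊢; omega) hr.left hss) hss

theorem Exchange.red_succ (hn : Exchange A n) {w w' : Word S} (hl : w.length ≤ n + 1)
    (hr : Red A w) (hs : Sim A w w') : Red A w' := by
  induction hs with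
  | refl => exact hr
  | tail h h' ih => exact hn.red_move (Sim.length_eq h ▸ hl) ih h'

theorem Exchange.lastRel_move (hn : Exchange A n) {x y : Word S} {a b : S × Bool}
    (hl : x.length ≤ n) (hr : Red A (x ++ [a])) (hs : Move A (x ++ [a]) (y ++ [b])) : LastRel A x a y b := by
  obtain ⟨T, p, q, u, u', hT, hu, hu', he, h1, h2⟩ := hs
  rcases List.eq_nil_or_concat q with rfl | ⟨q, c, rfl⟩
  · rw [append_nil] at h1 h2
    have hlu := hu.length_eq hu' he
    rcases List.eq_nil_or_concat u with rfl | ⟨u, a', rfl⟩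
    · obtain rfl : u' = [] := List.length_eq_zero_iff.1 hlu.symm
      obtain ⟨rfl, h3⟩ := append_inj' (h1.trans h2.symm) rfl
      exact .inl ⟨by simpa using h3, Sim.refl _⟩
    rcases List.eq_nil_or_concat u' with rfl | ⟨u', b', rfl⟩
    · simp at hlu
    simp only [concat_eq_append, ← append_assoc] at *
    obtain ⟨rfl, h3⟩ := append_inj' h1 rfl
    obtain ⟨rfl, h4⟩ := append_inj' h2 rfl
    obtain rfl : a = a' := by simpa using h3
    obtain rfl : b = b' := by simpa using h4
    have ha : a.1 ∈ T := hu.1 a (by simp)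
    have hb : b.1 ∈ T := hu'.1 b (by simp)
    by_cases hab : a.1 = b.1
    · obtain ⟨x, α⟩ := a
      obtain ⟨y, β⟩ := b
      obtain rfl : x = y := hab
      obtain rfl := hT.sign_unique hu hu' he
      exact .inl ⟨rfl, (hT.sim hu.left hu'.left (wbar_cancel_right he)).append_left p⟩
    · refine .inr ⟨hab, ?_⟩
      obtain rfl := hT.eq_pair ha hb hab
      obtain ⟨v, g, h5, h6, h7⟩ := exists_gate A {a.1, b.1} p
      have hr' := hr
      rw [append_assoc] at hr'
      have hvg := hn.red (by simp at hl; omega) hr'.left h5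
      have h8 := hr'.congr_left hvg h5
      rw [append_assoc] at h8
      have h9 := h8.geo hT (wordOver_append.2 ⟨h6, hu.1⟩)
      have e : wbar (A.on {a.1, b.1}) (g ++ (u' ++ [b])) =
          wbar (A.on {a.1, b.1}) (g ++ (u ++ [a])) := by
        rw [wbar_append, ← he, ← wbar_append]
      have h10 := h9.of_eq (wordOver_append.2 ⟨h6, hu'.1⟩) e (by simp at hlu ⊢; omega)
      rw [← append_assoc] at h9 h10 e
      rw [← append_assoc g] at e
      refine ⟨v, g ++ u, g ++ u', hvg.left, h7, ?_, ?_, h9, h10, e.symm⟩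
      · rw [← append_assoc]
        exact h5.append_right u
      · rw [← append_assoc]
        exact h5.append_right u'
  · simp only [concat_eq_append, ← append_assoc] at h1 h2
    obtain ⟨rfl, h3⟩ := append_inj' h1 rfl
    obtain ⟨rfl, h4⟩ := append_inj' h2 rfl
    exact .inl ⟨by simpa using h3.trans h4.symm, (hT.sim hu hu' he).append p q⟩

theorem Exchange.lastRel_trans (hn : Exchange A n) (hA : ∀ s t : S, s ≠ t → 3 ≤ A.m s t)
    {x y z : Word S} {a b c : S × Bool} (hl : y.length ≤ n) (hr : Red A y)
    (h : LastRel A x a y b) (h' : LastRel A y b z c) : LastRel A x a z c := by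
  rcases h with ⟨rfl, h⟩ | h
  · rcases h' with ⟨rfl, h'⟩ | h'
    · exact .inl ⟨rfl, h.trans h'⟩
    · exact .inr (h'.symm.congr_right h.symm).symm
  rcases h' with ⟨rfl, h'⟩ | h'
  · exact .inr (h.congr_right h')
  by_cases hac : a.1 = c.1
  · obtain ⟨hab, v, k, k', -, h2, h3, h4, h5, h6, h7⟩ := h
    obtain ⟨-, v', l, l', -, g2, g3, g4, g5, g6, g7⟩ := h'
    rw [Set.pair_comm, ← hac] at g2 g5 g6 g7
    have hT : IsPair A {a.1, b.1} := ⟨_, _, hab, hA _ _ hab, rfl⟩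
    obtain ⟨e1, e2⟩ := hn.gate_unique hT (h4.length_eq ▸ hl) (hn.red hl hr h4)
      (h4.symm.trans g3) h2 g2 h6.left.1 g5.left.1
    have e3 : wbar (A.on {a.1, b.1}) (k ++ [a]) = wbar (A.on {a.1, b.1}) (l' ++ [c]) := by
      rw [h7, wbar_append, e2, ← wbar_append, g7]
    obtain ⟨s, α⟩ := a
    obtain ⟨t, γ⟩ := c
    obtain rfl : s = t := hac
    obtain rfl := hT.sign_unique h5 g6 e3
    refine .inl ⟨rfl, (h3.trans ?_).trans g4.symm⟩
    exact (e1.append_right k).trans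
      ((hT.sim h5.left g6.left (wbar_cancel_right e3)).append_left v')
  · have hab := h.1
    have hbc := h'.1
    obtain ⟨y₀, y₁, h0, h1, h2, h3, h4⟩ := h.unwind hn hA hl
    obtain ⟨z₀, z₁, -, g1, g2, -, -⟩ := h'.symm.unwind hn hA hl
    have hly : y₀.length ≤ y.length := by
      obtain ⟨-, u, -, hu⟩ := h1
      have := hu.length_eq
      simp at this
      omega
    have hss := hn.strip_unique hl hr g1 h1
    exact (hn.no_three hA hac hab (Ne.symm hbc) (hly.trans hl) h0 h2 (g2.congr hss) h3 h4).elim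

theorem Exchange.succ (hn : Exchange A n) (hA : ∀ s t : S, s ≠ t → 3 ≤ A.m s t) :
    Exchange A (n + 1) where
  red := hn.red_succ
  last {x a y b} hl hr hs := by
    generalize hz : y ++ [b] = z at hs
    induction hs generalizing y b with
    | refl =>
      obtain ⟨rfl, h⟩ := append_inj' hz rfl
      exact .inl ⟨by simpa using h.symm, Sim.refl _⟩
    | @tail z' z h h' ih =>
      subst hz
      have hlz := Sim.length_eq h
      rcases List.eq_nil_or_concat z' with rfl | ⟨y', b', rfl⟩
      · simp at hlz
      rw [concat_eq_append] at h h' hlz ih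
      have hly : y'.length ≤ n := by simp at hlz; omega
      have hr' := hn.red_succ (by simpa using hl) hr h
      exact hn.lastRel_trans hA hly hr'.left (ih rfl) (hn.lastRel_move hly hr' h')

theorem exchange (hA : ∀ s t : S, s ≠ t → 3 ≤ A.m s t) (n : ℕ) : Exchange A n := by
  induction n with
  | zero => exact exchange_zero
  | succ n ih => exact ih.succ hA

end ExchangeHolds

/-! ### The action on classes of reduced words -/

section Action

variable {A : ArtinData S} {T : Set S}

theorem Red.of_sim (hA : ∀ s t : S, s ≠ t → 3 ≤ A.m s t) {w w' : Word S} (h : Red A w)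
    (hs : Sim A w w') : Red A w' := (exchange hA _).red le_rfl h hs

theorem Red.sim_of_snoc (hA : ∀ s t : S, s ≠ t → 3 ≤ A.m s t) {x y : Word S} {a b : S × Bool}
    (h : Red A (x ++ [a])) (hab : a.1 = b.1) (hs : Sim A (x ++ [a]) (y ++ [b])) :
    a = b ∧ Sim A x y :=
  ((exchange hA _).last le_rfl h hs).resolve_right fun hj => hj.1 hab

/-- Right multiplication of the reduced word `w` by a letter may give the reduced word `w'`. -/
def Step (A : ArtinData S) (x : S) (b : Bool) (w w' : Word S) : Prop :=
  Sim A w' (w ++ [(x, b)]) ∨ Sim A w (w' ++ [(x, !b)])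

theorem Step.symm {x : S} {b : Bool} {w w' : Word S} (h : Step A x b w w') :
    Step A x (!b) w' w := by
  rcases h with h | h
  · exact .inr (by rwa [Bool.not_not])
  · exact .inl h

theorem Step.congr {x : S} {b : Bool} {w w' v v' : Word S} (h : Step A x b w w')
    (hs : Sim A w v) (hs' : Sim A w' v') : Step A x b v v' := by
  rcases h with h | h
  · exact .inl ((hs'.symm.trans h).trans (hs.append_right _))
  · exact .inr ((hs.symm.trans h).trans (hs'.append_right _))

theorem Red.exists_step (hA : ∀ s t : S, s ≠ t → 3 ≤ A.m s t) {w : Word S} (h : Red A w)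
    (x : S) (b : Bool) : ∃ w', Red A w' ∧ Step A x b w w' := by
  by_cases hd : ∃ w', Sim A w (w' ++ [(x, !b)])
  · obtain ⟨w', hw'⟩ := hd
    exact ⟨w', (h.of_sim hA hw').left, .inr hw'⟩
  · exact ⟨_, h.snoc fun w' hw' => hd ⟨w', hw'⟩, .inl (Sim.refl _)⟩

theorem Step.unique (hA : ∀ s t : S, s ≠ t → 3 ≤ A.m s t) {x : S} {b : Bool}
    {w w₁ w₂ : Word S} (h : Red A w) (hr₁ : Red A w₁) (hr₂ : Red A w₂) (h₁ : Step A x b w w₁)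
    (h₂ : Step A x b w w₂) : Sim A w₁ w₂ := by
  rcases h₁ with h₁ | h₁ <;> rcases h₂ with h₂ | h₂
  · exact h₁.trans h₂.symm
  · exact ((red_snoc_iff.1 (hr₁.of_sim hA h₁)).2 _ h₂).elim
  · exact ((red_snoc_iff.1 (hr₂.of_sim hA h₂)).2 _ h₁).elim
  · exact ((h.of_sim hA h₁).sim_of_snoc hA rfl (h₁.symm.trans h₂)).2

/-- Equivalence of reduced words. -/
def redSetoid (A : ArtinData S) : Setoid {w : Word S // Red A w} where
  r u v := Sim A u.1 v.1
  iseqv := ⟨fun _ => Sim.refl _, Sim.symm, Sim.trans⟩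

/-- The class of a reduced word. -/
def cls {w : Word S} (h : Red A w) : Quotient (redSetoid A) :=
  Quotient.mk (redSetoid A) ⟨w, h⟩

theorem cls_eq {w w' : Word S} {h : Red A w} {h' : Red A w'} :
    cls h = cls h' ↔ Sim A w w' := Quotient.eq (r := redSetoid A)

/-- The action of a letter on classes of reduced words. -/
noncomputable def stepFun (hA : ∀ s t : S, s ≠ t → 3 ≤ A.m s t) (x : S) (b : Bool)
    (c : Quotient (redSetoid A)) : Quotient (redSetoid A) :=
  cls (c.out.2.exists_step hA x b).choose_spec.1

theorem stepFun_cls (hA : ∀ s t : S, s ≠ t → 3 ≤ A.m s t) {x : S} {b : Bool} {w w' : Word S}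
    (h : Red A w) (h' : Red A w') (hs : Step A x b w w') :
    stepFun hA x b (cls h) = cls h' := by
  have h1 : Sim A (cls h).out.1 w := Quotient.mk_out (s := redSetoid A) ⟨w, h⟩
  have h2 := (cls h).out.2.exists_step hA x b
  exact cls_eq.2 (Step.unique hA h h2.choose_spec.1 h'
    (h2.choose_spec.2.congr h1 (Sim.refl _)) hs)

theorem stepFun_stepFun (hA : ∀ s t : S, s ≠ t → 3 ≤ A.m s t) (x : S) (b : Bool)
    (c : Quotient (redSetoid A)) : stepFun hA x (!b) (stepFun hA x b c) = c := by
  induction c using Quotient.inductionOn with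
  | h w =>
    obtain ⟨w, h⟩ := w
    obtain ⟨w', h', hs⟩ := h.exists_step hA x b
    exact (congrArg _ (stepFun_cls hA h h' hs)).trans (stepFun_cls hA h' h hs.symm)

/-- The permutation of classes of reduced words induced by a generator. -/
noncomputable def genPerm (hA : ∀ s t : S, s ≠ t → 3 ≤ A.m s t) (x : S) :
    Equiv.Perm (Quotient (redSetoid A)) where
  toFun := stepFun hA x true
  invFun := stepFun hA x false
  left_inv := stepFun_stepFun hA x true
  right_inv := stepFun_stepFun hA x false

/-- The action of a word, letters acting from left to right. -/
noncomputable def run (hA : ∀ s t : S, s ≠ t → 3 ≤ A.m s t) (w : Word S) :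
    Equiv.Perm (Quotient (redSetoid A)) :=
  ((w.map fun a => cond a.2 (genPerm hA a.1)⁻¹ (genPerm hA a.1)⁻¹⁻¹).prod)⁻¹

theorem run_nil (hA : ∀ s t : S, s ≠ t → 3 ≤ A.m s t) (c : Quotient (redSetoid A)) :
    run hA [] c = c := by simp [run]

theorem run_snoc (hA : ∀ s t : S, s ≠ t → 3 ≤ A.m s t) (w : Word S) (x : S) (b : Bool)
    (c : Quotient (redSetoid A)) :
    run hA (w ++ [(x, b)]) c = stepFun hA x b (run hA w c) := by
  simp only [run, map_append, prod_append, map_cons, map_nil, prod_singleton, mul_inv_rev]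
  cases b
  · simp only [cond_false, inv_inv]; rfl
  · simp only [cond_true, inv_inv]; rfl

theorem run_cls (hA : ∀ s t : S, s ≠ t → 3 ≤ A.m s t) (hT : IsPair A T) {v g g' q : Word S}
    (hv : Red A v) (hd : NoDesc A T v) (hg : Geo A T g) (hq : WordOver T q) (hg' : Geo A T g')
    (he : wbar (A.on T) g' = wbar (A.on T) (g ++ q)) (h : Red A (v ++ g))
    (h' : Red A (v ++ g')) : run hA q (cls h) = cls h' := by
  induction q using List.reverseRecOn generalizing g' with
  | nil =>
    rw [append_nil] at he
    rw [run_nil, cls_eq]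
    exact (hT.sim hg hg' he.symm).append_left v
  | append_singleton q a ih =>
    obtain ⟨x, b⟩ := a
    obtain ⟨hq, hx⟩ := wordOver_append.1 hq
    obtain ⟨g₀, h1, h2⟩ := exists_geo (A := A) (wordOver_append.2 ⟨hg.1, hq⟩)
    have h3 := (exchange hA _).red_append hT (Nat.le_succ _) hv hd h1
    have he' : wbar (A.on T) g' = wbar (A.on T) (g₀ ++ [(x, b)]) := by
      rw [he, ← append_assoc, wbar_append, ← h2, ← wbar_append]
    rw [run_snoc, ih hq h1 h2 h3]
    refine stepFun_cls hA h3 h' ?_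
    rcases h1.append_or (wordOver_singleton.1 hx) b with h4 | ⟨u, h4, h5⟩
    · left
      rw [append_assoc]
      exact (hT.sim hg' h4 he').append_left v
    · right
      have e : wbar (A.on T) (g' ++ [(x, !b)]) = wbar (A.on T) g₀ := by
        rw [wbar_append, he', wbar_append, wbar_singleton_not, mul_inv_cancel_right]
      have e2 : wbar (A.on T) g' = wbar (A.on T) u := wbar_cancel_right (e.trans h5.symm)
      rw [append_assoc]
      refine (hT.sim h1 (h1.of_eq ?_ e ?_) e.symm).append_left v
      · exact wordOver_append.2 ⟨hg'.1, by simpa using hx⟩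
      · rw [← h4.length_eq h1 h5]
        simp [hg'.length_eq h4.left e2]

theorem wordOver_altWord {s t : S} (hs : s ∈ T) (ht : t ∈ T) (k : ℕ) :
    WordOver T (altWord s t k) := by
  induction k generalizing s t with
  | zero => exact wordOver_nil
  | succ k ih => exact (wordOver_append (u := [(s, true)])).2 ⟨by simpa, ih ht hs⟩

theorem run_eq_of_isRel (hA : ∀ s t : S, s ≠ t → 3 ≤ A.m s t) {u v : Word S}
    (h : IsRel A u v) : run hA u = run hA v := by
  obtain ⟨s, t, k, hst, hk, rfl, rfl⟩ := h
  have hT : IsPair A {s, t} := ⟨s, t, hst, hA s t hst, rfl⟩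
  have hrel : wbar (A.on {s, t}) (altWord s t k) = wbar (A.on {s, t}) (altWord t s k) :=
    wbar_eq_of_isRel ⟨s, t, k, hst, by simpa [ArtinData.on] using hk, rfl, rfl⟩
  ext c
  induction c using Quotient.inductionOn with
  | h w =>
    obtain ⟨w, hw⟩ := w
    change run hA _ (cls hw) = run hA _ (cls hw)
    obtain ⟨v, g, h1, h2, h3⟩ := exists_gate A {s, t} w
    have h4 := hw.of_sim hA h1
    have h5 := h4.geo hT h2
    have ho := wordOver_altWord (T := {s, t}) (s := s) (t := t) (by simp) (by simp) k
    have ho' := wordOver_altWord (T := {s, t}) (s := t) (t := s) (by simp) (by simp) k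
    obtain ⟨g', h6, h7⟩ := exists_geo (A := A) (wordOver_append.2 ⟨h2, ho⟩)
    have h8 := (exchange hA _).red_append hT (Nat.le_succ _) h4.left h3 h6
    rw [show cls hw = cls h4 from cls_eq.2 h1, run_cls hA hT h4.left h3 h5 ho h6 h7 h4 h8,
      run_cls hA hT h4.left h3 h5 ho' h6 (by rw [h7, wbar_append, hrel, wbar_append]) h4 h8]

theorem run_red (hA : ∀ s t : S, s ≠ t → 3 ≤ A.m s t) {w : Word S} (h : Red A w) :
    run hA w (cls Red.nil) = cls h := by
  induction w using List.reverseRecOn with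
  | nil => exact run_nil hA _
  | append_singleton w a ih =>
    obtain ⟨x, b⟩ := a
    rw [run_snoc, ih h.left]
    exact stepFun_cls hA _ _ (.inl (Sim.refl _))

/-- Reduced words representing the same element differ by dihedral moves. -/
theorem Red.sim_of_wbar_eq (hA : ∀ s t : S, s ≠ t → 3 ≤ A.m s t) {w w' : Word S}
    (h : Red A w) (h' : Red A w') (he : wbar A w = wbar A w') : Sim A w w' := by
  obtain ⟨φ, hφ⟩ := exists_hom A (fun x => (genPerm hA x)⁻¹) fun u v huv =>
    inv_injective (run_eq_of_isRel hA huv)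
  have hr : run hA w = run hA w' := by
    rw [run, run, ← hφ, ← hφ, he]
  rw [← cls_eq (h := h) (h' := h'), ← run_red hA h, ← run_red hA h', hr]

end Action

/-! ### Parabolic cosets -/

section Parabolic

variable {A : ArtinData S} {S₀ : Set S}

theorem exists_red (hA : ∀ s t : S, s ≠ t → 3 ≤ A.m s t) (w : Word S) :
    ∃ w', Red A w' ∧ wbar A w' = wbar A w ∧ w'.length ≤ w.length ∧
      ∀ S₀, WordOver S₀ w → WordOver S₀ w' := by
  induction w using List.reverseRecOn with
  | nil => exact ⟨[], .nil, rfl, le_rfl, fun _ h => h⟩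
  | append_singleton w a ih =>
    obtain ⟨x, b⟩ := a
    obtain ⟨w', h1, h2, h3, h4⟩ := ih
    by_cases hd : ∃ v, Sim A w' (v ++ [(x, !b)])
    · obtain ⟨v, hv⟩ := hd
      have hl := hv.length_eq
      refine ⟨v, (h1.of_sim hA hv).left, ?_, ?_, fun S₀ h => ?_⟩
      · rw [wbar_append, ← h2, hv.wbar_eq, wbar_append, wbar_singleton_not,
          inv_mul_cancel_right]
      · simp at hl ⊢
        omega
      · exact (wordOver_append.1 (hv.wordOver (h4 _ (wordOver_append.1 h).1))).1
    · refine ⟨_, h1.snoc fun v hv => hd ⟨v, hv⟩, ?_, ?_, fun S₀ h => ?_⟩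
      · rw [wbar_append, h2, wbar_append]
      · simpa using h3
      · exact wordOver_append.2 ⟨h4 _ (wordOver_append.1 h).1, (wordOver_append.1 h).2⟩

theorem Red.elLength_eq (hA : ∀ s t : S, s ≠ t → 3 ≤ A.m s t) {w : Word S} (h : Red A w) :
    elLength A (wbar A w) = w.length := by
  refine le_antisymm (Nat.sInf_le ⟨w, rfl, rfl⟩) ?_
  obtain ⟨w', h1, h2⟩ := Nat.sInf_mem
    (s := {n | ∃ w' : Word S, wbar A w' = wbar A w ∧ w'.length = n}) ⟨_, w, rfl, rfl⟩
  obtain ⟨v, h3, h4, h5, -⟩ := exists_red hA w'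
  rw [(h.sim_of_wbar_eq hA h3 (h1.symm.trans h4.symm)).length_eq]
  exact h5.trans h2.le

theorem exists_word (A : ArtinData S) (x : ArtinGroup A) : ∃ w, wbar A w = x := by
  obtain ⟨f, rfl⟩ := PresentedGroup.mk_surjective _ x
  exact ⟨f.toWord, congrArg _ FreeGroup.mk_toWord⟩

theorem exists_wordOver_of_mem_parab {x : ArtinGroup A} (h : x ∈ parab A S₀) :
    ∃ w, WordOver S₀ w ∧ wbar A w = x := by
  induction h using Subgroup.closure_induction with
  | mem x hx =>
    obtain ⟨s, hs, rfl⟩ := hx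
    exact ⟨_, by simpa, rfl⟩
  | one => exact ⟨[], wordOver_nil, rfl⟩
  | mul x y _ _ hx hy =>
    obtain ⟨u, hu, rfl⟩ := hx
    obtain ⟨v, hv, rfl⟩ := hy
    exact ⟨u ++ v, wordOver_append.2 ⟨hu, hv⟩, wbar_append A u v⟩
  | inv x _ hx =>
    obtain ⟨u, hu, rfl⟩ := hx
    refine ⟨wordInv u, fun l hl => ?_, wbar_wordInv A u⟩
    simp only [wordInv, mem_map, mem_reverse] at hl
    obtain ⟨a, ha, rfl⟩ := hl
    exact hu a ha

theorem wbar_mem_parab {s : S} (hs : s ∈ S₀) (b : Bool) : wbar A [(s, b)] ∈ parab A S₀ := by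
  have h : wbar A [(s, true)] ∈ parab A S₀ := Subgroup.subset_closure ⟨s, hs, rfl⟩
  cases b
  · exact wbar_singleton_not A s true ▸ inv_mem h
  · exact h

/-- Reduced words over `S₀` can be appended to a reduced word without descents in `S₀`, and
all the descents in `S₀` then come from the suffix. -/
theorem Red.append_parabolic (hA : ∀ s t : S, s ≠ t → 3 ≤ A.m s t) {v u : Word S}
    (hv : Red A v) (hd : NoDesc A S₀ v) (hu : Red A u) (ho : WordOver S₀ u) :
    Red A (v ++ u) ∧ ∀ x ∈ S₀, ∀ b w, Sim A (v ++ u) (w ++ [(x, b)]) →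
      ∃ u', Sim A u (u' ++ [(x, b)]) := by
  induction hm : u.length using Nat.strong_induction_on generalizing u with
  | _ m ih =>
  rcases List.eq_nil_or_concat u with rfl | ⟨u₀, ⟨y, c⟩, rfl⟩
  · rw [append_nil]
    exact ⟨hv, fun x hx b w hw => (hd x hx ⟨w, b, hw⟩).elim⟩
  rw [concat_eq_append] at *
  obtain ⟨ho0, hy⟩ := wordOver_append.1 ho
  rw [wordOver_singleton] at hy
  obtain ⟨h1, h2⟩ := ih _ (by simp at hm; omega) hu.left ho0 rfl
  have hr : Red A (v ++ (u₀ ++ [(y, c)])) := by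
    rw [← append_assoc]
    refine h1.snoc fun w hw => ?_
    obtain ⟨u', hu'⟩ := h2 y hy (!c) w hw
    exact (red_snoc_iff.1 hu).2 u' hu'
  refine ⟨hr, fun x hx b w hw => ?_⟩
  by_cases hxy : y = x
  · subst hxy
    rw [← append_assoc] at hr hw
    have hcb := (hr.sim_of_snoc (a := (y, c)) (b := (y, b)) hA rfl hw).1
    exact ⟨u₀, hcb ▸ Sim.refl _⟩
  · have hT : IsPair A {y, x} := ⟨y, x, hxy, hA y x hxy, rfl⟩
    obtain ⟨u₁, u₂, h3, h4, h5⟩ := exists_gate A {y, x} (u₀ ++ [(y, c)])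
    have hu12 := hu.of_sim hA h3
    have hlt : u₁.length < m := by
      by_contra hlt
      have hl := h3.length_eq
      rw [hm, length_append] at hl
      obtain rfl : u₂ = [] := List.length_eq_zero_iff.1 (by omega)
      rw [append_nil] at h3
      exact h5 y (by simp) ⟨u₀, c, h3.symm⟩
    obtain ⟨h6, h7⟩ := ih _ hlt hu12.left (wordOver_append.1 (h3.wordOver ho)).1 rfl
    have h8 : NoDesc A {y, x} (v ++ u₁) := by
      rintro q hq ⟨w', d, hw'⟩
      have hq0 : q ∈ S₀ := by
        rcases hq with rfl | rfl
        · exact hy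
        · exact hx
      obtain ⟨u', hu'⟩ := h7 q hq0 d w' hw'
      exact h5 q hq ⟨u', d, hu'⟩
    have h9 := h3.append_left v
    have h10 := hr.of_sim hA h9
    rw [← append_assoc v u₁] at h9 h10
    have hg := hu12.geo hT h4
    obtain ⟨u', h11, h12⟩ := (exchange hA _).gate_desc hT le_rfl h10 h8 hg
      (by simp) (h9.symm.trans hw)
    refine ⟨u₁ ++ u', ?_⟩
    rw [append_assoc]
    exact h3.trans ((hT.sim hg h11 h12.symm).append_left u₁)

theorem exists_red_of_minimal (hA : ∀ s t : S, s ≠ t → 3 ≤ A.m s t) {x : ArtinGroup A}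
    (hx : ∀ y, x⁻¹ * y ∈ parab A S₀ → elLength A x ≤ elLength A y) :
    ∃ v, Red A v ∧ NoDesc A S₀ v ∧ wbar A v = x := by
  obtain ⟨w, rfl⟩ := exists_word A x
  obtain ⟨v, h1, h2, -⟩ := exists_red hA w
  refine ⟨v, h1, fun q hq ⟨v', b, hv⟩ => ?_, h2⟩
  have hr := h1.of_sim hA hv
  have he : wbar A w = wbar A v' * wbar A [(q, b)] := by
    rw [← h2, hv.wbar_eq, wbar_append]
  have h3 := hx (wbar A v') (by
    rw [he, mul_inv_rev, inv_mul_cancel_right]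
    exact inv_mem (wbar_mem_parab hq b))
  rw [← h2, h1.elLength_eq hA, hr.left.elLength_eq hA, hv.length_eq] at h3
  simp at h3

theorem eq_of_minimal (hA : ∀ s t : S, s ≠ t → 3 ≤ A.m s t) {x y : ArtinGroup A}
    (hx : ∀ z, x⁻¹ * z ∈ parab A S₀ → elLength A x ≤ elLength A z)
    (hxy : x⁻¹ * y ∈ parab A S₀) (hl : elLength A y ≤ elLength A x) : y = x := by
  obtain ⟨v, h1, h2, rfl⟩ := exists_red_of_minimal hA hx
  obtain ⟨w, h3, h4⟩ := exists_wordOver_of_mem_parab hxy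
  obtain ⟨u, h5, h6, -, h7⟩ := exists_red hA w
  have hy : y = wbar A (v ++ u) := by
    rw [wbar_append, h6, h4, mul_inv_cancel_left]
  rw [hy, h1.elLength_eq hA, (h1.append_parabolic hA h2 h5 (h7 _ h3)).1.elLength_eq hA,
    length_append] at hl
  obtain rfl : u = [] := List.length_eq_zero_iff.1 (by omega)
  rw [hy, append_nil]

end Parabolic

/-- Corollary 4.2: in an Artin–Tits group of large type, the family
`(T(S₀))_{S₀⊆S}`, where `T(S₀)` is the set of elements of minimal length in their left
`A_{S₀}`-coset, is an `S`-sequence of transversals. -/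
theorem stmt16 {S : Type*} [Finite S] (A : ArtinData S)
    (hlarge : ∀ s t : S, s ≠ t → 3 ≤ A.m s t) :
    ∀ S₀ : Set S, IsLeftTransversal (parab A S₀)
      {x : ArtinGroup A | ∀ y : ArtinGroup A, x⁻¹ * y ∈ parab A S₀ →
        elLength A x ≤ elLength A y} := by
  refine fun S₀ => ⟨fun y _ => ?_, fun g => ?_⟩
  · have := Red.elLength_eq hlarge (Red.nil (A := A))
    rw [wbar_nil] at this
    rw [this]
    exact Nat.zero_le _
  · have hex : ∃ n x, g⁻¹ * x ∈ parab A S₀ ∧ elLength A x = n := ⟨_, g, by simp, rfl⟩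
    obtain ⟨x, hx, hn⟩ := Nat.find_spec hex
    have hmem : ∀ y, g⁻¹ * y ∈ parab A S₀ → x⁻¹ * y ∈ parab A S₀ := fun y hy => by
      have := mul_mem (inv_mem hx) hy
      rwa [mul_inv_rev, inv_inv, mul_assoc, mul_inv_cancel_left] at this
    have hmin : ∀ y, x⁻¹ * y ∈ parab A S₀ → elLength A x ≤ elLength A y := fun y hy => by
      have := mul_mem hx hy
      rw [mul_assoc, mul_inv_cancel_left] at this
      exact hn ▸ Nat.find_min' hex ⟨y, this, rfl⟩
    refine ⟨x, ⟨hmin, hx⟩, fun y ⟨hy, hgy⟩ => ?_⟩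
    have hxy := hmem y hgy
    refine eq_of_minimal hlarge hmin hxy (hy x ?_)
    have := inv_mem hxy
    rwa [mul_inv_rev, inv_inv] at this

end ArtinTits
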